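/- Let Λ be a finite dimensional algebra over a field K and let M ∈ mod Λ have no nonzero projective direct summand. Then the following are equivalent: (1) M is a Gorenstein projective τ-tilting Λ-module; (2) Tr M is a Gorenstein projective τ-tilting Λ^op-module; (3) τM is a Gorenstein injective τ⁻¹-tilting Λ-module. -/

import Mathlib

/-!  Common definitions: Gorenstein projective/injective modules, transpose,
Auslander–Reiten translation, τ-rigid and τ-tilting modules and pairs,
torsion pairs, etc., over a finite dimensional algebra.
Throughout, "mod Λ" is modelled by the category of finitely generated
(left) modules over a finite dimensional `K`-algebra `R`, and
"mod Λᵒᵖ" by finitely generated `Rᵐᵒᵖ`-modules. -/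

universe u

open Function MulOpposite

namespace GPTau

section Ring

variable (R : Type u) [Ring R]

/-- A submodule `N ≤ M` is superfluous (small) if `N ⊔ N' = ⊤` implies `N' = ⊤`. -/
def IsSuperfluous {M : Type u} [AddCommGroup M] [Module R M] (N : Submodule R M) : Prop :=
  ∀ N' : Submodule R M, N ⊔ N' = ⊤ → N' = ⊤

/-- `M` is Gorenstein projective: there is a doubly infinite exact sequence of
finitely generated projective modules which stays exact under `Hom(-, R)` and
such that `M ≅ Im (P₋₁ → P₀)`. -/
def IsGP (M : Type u) [AddCommGroup M] [Module R M] : Prop :=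
  ∃ (P : ℤ → Type u) (_ : ∀ n, AddCommGroup (P n)) (_ : ∀ n, Module R (P n))
    (d : ∀ n : ℤ, P n →ₗ[R] P (n + 1)),
    (∀ n, Module.Finite R (P n)) ∧
    (∀ n, Module.Projective R (P n)) ∧
    (∀ n, Function.Exact (d n) (d (n + 1))) ∧
    (∀ n, Function.Exact
      (fun g : P (n + 1 + 1) →ₗ[R] R => g.comp (d (n + 1)))
      (fun g : P (n + 1) →ₗ[R] R => g.comp (d n))) ∧
    Nonempty (M ≃ₗ[R] LinearMap.range (d (-1)))

/-- A linear map factors through a (finitely generated) projective module. -/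
def FactorsThroughProj {A B : Type u} [AddCommGroup A] [Module R A]
    [AddCommGroup B] [Module R B] (f : A →ₗ[R] B) : Prop :=
  ∃ (Q : Type u) (_ : AddCommGroup Q) (_ : Module R Q),
    Module.Projective R Q ∧ ∃ (a : A →ₗ[R] Q) (b : Q →ₗ[R] B), b.comp a = f

/-- Two maps are equal in the stable category (mod projectives). -/
def StEq {A B : Type u} [AddCommGroup A] [Module R A] [AddCommGroup B] [Module R B]
    (f g : A →ₗ[R] B) : Prop :=
  FactorsThroughProj R (f - g)

/-- An indecomposable module. -/
def IsIndec (M : Type u) [AddCommGroup M] [Module R M] : Prop :=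
  Nontrivial M ∧ ∀ N₁ N₂ : Submodule R M, IsCompl N₁ N₂ → N₁ = ⊥ ∨ N₂ = ⊥

/-- `|M| = k` : `M` decomposes into indecomposable direct summands having
exactly `k` isomorphism classes. -/
def NumIndec (M : Type u) [AddCommGroup M] [Module R M] (k : ℕ) : Prop :=
  ∃ (n : ℕ) (N : Fin n → Submodule R M),
    DirectSum.IsInternal N ∧ (∀ i, IsIndec R (N i)) ∧
    ∃ c : Fin n → Fin k, Surjective c ∧
      ∀ i j, (c i = c j ↔ Nonempty ((N i) ≃ₗ[R] (N j)))

/-- A basic module: it is a direct sum of pairwise nonisomorphic indecomposables. -/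
def IsBasic (M : Type u) [AddCommGroup M] [Module R M] : Prop :=
  ∃ (n : ℕ) (N : Fin n → Submodule R M),
    DirectSum.IsInternal N ∧ (∀ i, IsIndec R (N i)) ∧
    ∀ i j, i ≠ j → ¬ Nonempty ((N i) ≃ₗ[R] (N j))

/-- `M` has no nonzero projective direct summand. -/
def NoProjSummand (M : Type u) [AddCommGroup M] [Module R M] : Prop :=
  ∀ N₁ N₂ : Submodule R M, IsCompl N₁ N₂ → Module.Projective R N₁ → N₁ = ⊥

/-- `X` is a direct summand of `T`. -/
def IsDirectSummand (X T : Type u) [AddCommGroup X] [Module R X]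
    [AddCommGroup T] [Module R T] : Prop :=
  ∃ (i : X →ₗ[R] T) (p : T →ₗ[R] X), p.comp i = LinearMap.id

/-- `Ext¹(X, Y) = 0`: every short exact sequence `0 → Y → E → X → 0` splits. -/
def Ext1Vanishes (X Y : Type u) [AddCommGroup X] [Module R X]
    [AddCommGroup Y] [Module R Y] : Prop :=
  ∀ (E : Type u) [AddCommGroup E] [Module R E] (i : Y →ₗ[R] E) (p : E →ₗ[R] X),
    Injective i → Surjective p → Function.Exact i p →
    ∃ s : X →ₗ[R] E, p.comp s = LinearMap.id

/-- `X ∈ Fac G`: `X` is a quotient of a finite direct sum of copies of `G`. -/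
def FacOf (G X : Type u) [AddCommGroup G] [Module R G] [AddCommGroup X] [Module R X] : Prop :=
  ∃ (n : ℕ) (p : (Fin n → G) →ₗ[R] X), Surjective p

/-- `X ∈ Sub C`: `X` embeds into a finite direct sum of copies of `C`. -/
def SubOf (C X : Type u) [AddCommGroup C] [Module R C] [AddCommGroup X] [Module R X] : Prop :=
  ∃ (n : ℕ) (i : X →ₗ[R] (Fin n → C)), Injective i

/-- `X ∈ add G`: `X` is a direct summand of a finite direct sum of copies of `G`. -/
def InAdd (G X : Type u) [AddCommGroup G] [Module R G] [AddCommGroup X] [Module R X] : Prop :=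
  ∃ (n : ℕ) (i : X →ₗ[R] (Fin n → G)) (p : (Fin n → G) →ₗ[R] X), p.comp i = LinearMap.id

/-- The Jacobson radical of `R` (as a left ideal). -/
def JacobsonRad : Ideal R := (⊥ : Ideal R).jacobson

/-- The Jacobson radical squares to zero. -/
def RadSquareZero : Prop :=
  ∀ x y : R, x ∈ JacobsonRad R → y ∈ JacobsonRad R → x * y = 0

/-- A uniserial module: its submodules form a chain. -/
def IsUniserial (M : Type u) [AddCommGroup M] [Module R M] : Prop :=
  ∀ N₁ N₂ : Submodule R M, N₁ ≤ N₂ ∨ N₂ ≤ N₁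

/-- `R` has finite global dimension: there is `n` such that every finitely
generated module has a projective resolution vanishing in degrees `> n`. -/
def FiniteGlobalDimension : Prop :=
  ∃ n : ℕ, ∀ (M : Type u) [AddCommGroup M] [Module R M], Module.Finite R M →
    ∃ (P : ℕ → Type u) (_ : ∀ i, AddCommGroup (P i)) (_ : ∀ i, Module R (P i))
      (d : ∀ i : ℕ, P (i + 1) →ₗ[R] P i) (ε : P 0 →ₗ[R] M),
      (∀ i, Module.Projective R (P i)) ∧ Surjective ε ∧
      Function.Exact (d 0) ε ∧ (∀ i, Function.Exact (d (i + 1)) (d i)) ∧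
      (∀ i, n < i → Subsingleton (P i))

/-- The injective dimension of `R` as a module over itself is at most 1. -/
def SelfInjDimLE1 : Prop :=
  ∃ (I₀ I₁ : Type u) (_ : AddCommGroup I₀) (_ : Module R I₀)
    (_ : AddCommGroup I₁) (_ : Module R I₁),
    Module.Finite R I₀ ∧ Module.Finite R I₁ ∧
    Module.Injective R I₀ ∧ Module.Injective R I₁ ∧
    ∃ (i : R →ₗ[R] I₀) (p : I₀ →ₗ[R] I₁),
      Injective i ∧ Surjective p ∧ Function.Exact i p

end Ring

section Algebra

variable (R : Type u) [Ring R] (K : Type u) [Field K] [Algebra K R]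

/-- For an algebra over a field, the scalars of the base field commute with the
ring action on any compatible module. -/
instance (priority := 100) smulCommClass_of_tower (M : Type u) [AddCommGroup M]
    [Module R M] [Module K M] [IsScalarTower K R M] : SMulCommClass R K M :=
  ⟨fun r k m => by
    rw [← algebraMap_smul R k m, ← mul_smul, ← Algebra.commutes, mul_smul, algebraMap_smul]⟩

end Algebra

section OpDual

variable (R : Type u) [Ring R] (K : Type u) [Field K] [Algebra K R]
variable (M : Type u) [AddCommGroup M] [Module Rᵐᵒᵖ M] [Module K M]
  [IsScalarTower K Rᵐᵒᵖ M]

/-- The `K`-dual of a (finitely generated) `Rᵐᵒᵖ`-module, as an `R`-module: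
this is the duality `D : mod Λᵒᵖ → mod Λ`. -/
def OpDual (R : Type u) [Ring R] (K : Type u) [Field K] [Algebra K R]
    (M : Type u) [AddCommGroup M] [Module Rᵐᵒᵖ M] [Module K M]
    [IsScalarTower K Rᵐᵒᵖ M] : Type u := M →ₗ[K] K

instance : AddCommGroup (OpDual R K M) := inferInstanceAs (AddCommGroup (M →ₗ[K] K))

instance : Module K (OpDual R K M) := inferInstanceAs (Module K (M →ₗ[K] K))

/-- Scalar action `x ↦ op r • x` as a `K`-linear map. -/
def opSmulHom (r : R) : M →ₗ[K] M where
  toFun x := op r • x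
  map_add' x y := smul_add _ x y
  map_smul' k x := smul_comm (op r) k x

/-- Reinterpret an element of the dual as a linear functional. -/
def OpDual.toL (f : OpDual R K M) : M →ₗ[K] K := f

lemma OpDual.toL_injective :
    Function.Injective (OpDual.toL R K M) := fun _ _ h => h

instance : SMul R (OpDual R K M) :=
  ⟨fun r f => ((OpDual.toL R K M f).comp (opSmulHom R K M r) : M →ₗ[K] K)⟩

lemma OpDual.smul_toL (r : R) (f : OpDual R K M) (x : M) :
    OpDual.toL R K M (r • f) x = OpDual.toL R K M f (op r • x) := rfl

lemma OpDual.toL_add (f g : OpDual R K M) :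
    OpDual.toL R K M (f + g) = OpDual.toL R K M f + OpDual.toL R K M g := rfl

lemma OpDual.toL_zero : OpDual.toL R K M 0 = 0 := rfl

instance : Module R (OpDual R K M) where
  one_smul f := OpDual.toL_injective R K M <| LinearMap.ext fun x => by
    rw [OpDual.smul_toL, op_one, one_smul]
  mul_smul r s f := OpDual.toL_injective R K M <| LinearMap.ext fun x => by
    rw [OpDual.smul_toL, OpDual.smul_toL, OpDual.smul_toL, op_mul, mul_smul]
  smul_zero r := OpDual.toL_injective R K M <| LinearMap.ext fun x => by
    rw [OpDual.smul_toL, OpDual.toL_zero]; simp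
  smul_add r f g := OpDual.toL_injective R K M <| LinearMap.ext fun x => by
    rw [OpDual.smul_toL, OpDual.toL_add]
    simp only [LinearMap.add_apply, OpDual.toL_add]
    rw [OpDual.smul_toL, OpDual.smul_toL]
  add_smul r s f := OpDual.toL_injective R K M <| LinearMap.ext fun x => by
    rw [OpDual.smul_toL]
    simp only [OpDual.toL_add, LinearMap.add_apply]
    rw [OpDual.smul_toL, OpDual.smul_toL, op_add, add_smul, map_add]
  zero_smul f := OpDual.toL_injective R K M <| LinearMap.ext fun x => by
    rw [OpDual.smul_toL, OpDual.toL_zero, op_zero, zero_smul, map_zero]; rfl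

instance : IsScalarTower K R (OpDual R K M) :=
  ⟨fun k r f => OpDual.toL_injective R K M <| LinearMap.ext fun x => by
    have h1 : OpDual.toL R K M ((k • r) • f) x = OpDual.toL R K M f (op (k • r) • x) := rfl
    have h2 : OpDual.toL R K M (k • (r • f)) x = k • OpDual.toL R K M f (op r • x) := rfl
    rw [h1, h2, op_smul, smul_assoc, map_smul]⟩

end OpDual

section LDual

variable (R : Type u) [Ring R] (K : Type u) [Field K] [Algebra K R]
variable (M : Type u) [AddCommGroup M] [Module R M] [Module K M]
  [IsScalarTower K R M]

/-- The `K`-dual of a (finitely generated) `R`-module, as an `Rᵐᵒᵖ`-module: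
this is the duality `D : mod Λ → mod Λᵒᵖ`. -/
def LDual (R : Type u) [Ring R] (K : Type u) [Field K] [Algebra K R]
    (M : Type u) [AddCommGroup M] [Module R M] [Module K M]
    [IsScalarTower K R M] : Type u := M →ₗ[K] K

instance : AddCommGroup (LDual R K M) := inferInstanceAs (AddCommGroup (M →ₗ[K] K))

instance : Module K (LDual R K M) := inferInstanceAs (Module K (M →ₗ[K] K))

/-- Scalar action `x ↦ r • x` as a `K`-linear map. -/
def lSmulHom (r : R) : M →ₗ[K] M where
  toFun x := r • x
  map_add' x y := smul_add _ x y
  map_smul' k x := smul_comm r k x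

/-- Reinterpret an element of the dual as a linear functional. -/
def LDual.toL (f : LDual R K M) : M →ₗ[K] K := f

lemma LDual.toL_injective : Function.Injective (LDual.toL R K M) := fun _ _ h => h

instance : SMul Rᵐᵒᵖ (LDual R K M) :=
  ⟨fun s f => ((LDual.toL R K M f).comp (lSmulHom R K M (unop s)) : M →ₗ[K] K)⟩

lemma LDual.smul_toL (s : Rᵐᵒᵖ) (f : LDual R K M) (x : M) :
    LDual.toL R K M (s • f) x = LDual.toL R K M f (unop s • x) := rfl

lemma LDual.toL_add (f g : LDual R K M) :
    LDual.toL R K M (f + g) = LDual.toL R K M f + LDual.toL R K M g := rfl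

lemma LDual.toL_zero : LDual.toL R K M 0 = 0 := rfl

instance : Module Rᵐᵒᵖ (LDual R K M) where
  one_smul f := LDual.toL_injective R K M <| LinearMap.ext fun x => by
    rw [LDual.smul_toL, unop_one, one_smul]
  mul_smul s t f := LDual.toL_injective R K M <| LinearMap.ext fun x => by
    rw [LDual.smul_toL, LDual.smul_toL, LDual.smul_toL, unop_mul, mul_smul]
  smul_zero s := LDual.toL_injective R K M <| LinearMap.ext fun x => by
    rw [LDual.smul_toL, LDual.toL_zero]; simp
  smul_add s f g := LDual.toL_injective R K M <| LinearMap.ext fun x => by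
    rw [LDual.smul_toL, LDual.toL_add]
    simp only [LinearMap.add_apply, LDual.toL_add]
    rw [LDual.smul_toL, LDual.smul_toL]
  add_smul s t f := LDual.toL_injective R K M <| LinearMap.ext fun x => by
    rw [LDual.smul_toL]
    simp only [LDual.toL_add, LinearMap.add_apply]
    rw [LDual.smul_toL, LDual.smul_toL, unop_add, add_smul, map_add]
  zero_smul f := LDual.toL_injective R K M <| LinearMap.ext fun x => by
    rw [LDual.smul_toL, LDual.toL_zero, unop_zero, zero_smul, map_zero]; rfl

instance : IsScalarTower K Rᵐᵒᵖ (LDual R K M) :=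
  ⟨fun k s f => LDual.toL_injective R K M <| LinearMap.ext fun x => by
    have h1 : LDual.toL R K M ((k • s) • f) x = LDual.toL R K M f (unop (k • s) • x) := rfl
    have h2 : LDual.toL R K M (k • (s • f)) x = k • LDual.toL R K M f (unop s • x) := rfl
    rw [h1, h2, unop_smul, smul_assoc, map_smul]⟩

end LDual

section GI

variable (R : Type u) [Ring R] (K : Type u) [Field K] [Algebra K R]

/-- `M` is Gorenstein injective: there is a doubly infinite exact sequence of
finitely generated injective modules which stays exact under `Hom(DΛ, -)` and
such that `M ≅ Im (I₋₁ → I₀)`. Here `DΛ = OpDual R K R` is the `K`-dual of the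
regular module. -/
def IsGI (M : Type u) [AddCommGroup M] [Module R M] : Prop :=
  ∃ (I : ℤ → Type u) (_ : ∀ n, AddCommGroup (I n)) (_ : ∀ n, Module R (I n))
    (d : ∀ n : ℤ, I n →ₗ[R] I (n + 1)),
    (∀ n, Module.Finite R (I n)) ∧
    (∀ n, Module.Injective R (I n)) ∧
    (∀ n, Function.Exact (d n) (d (n + 1))) ∧
    (∀ n, Function.Exact
      (fun g : OpDual R K R →ₗ[R] I n => (d n).comp g)
      (fun g : OpDual R K R →ₗ[R] I (n + 1) => (d (n + 1)).comp g)) ∧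
    Nonempty (M ≃ₗ[R] LinearMap.range (d (-1)))

end GI



section MinPres

variable (R : Type u) [Ring R]

/-- A minimal projective presentation `P₁ → P₀ → M → 0`. -/
structure MinPres (M : Type u) [AddCommGroup M] [Module R M] : Type (u + 1) where
  P₁ : Type u
  P₀ : Type u
  [acg₁ : AddCommGroup P₁]
  [acg₀ : AddCommGroup P₀]
  [mod₁ : Module R P₁]
  [mod₀ : Module R P₀]
  fin₁ : Module.Finite R P₁
  fin₀ : Module.Finite R P₀
  proj₁ : Module.Projective R P₁
  proj₀ : Module.Projective R P₀
  d : P₁ →ₗ[R] P₀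
  p : P₀ →ₗ[R] M
  surj : Function.Surjective p
  exact : Function.Exact d p
  min₀ : IsSuperfluous R (LinearMap.ker p)
  min₁ : IsSuperfluous R (LinearMap.ker d)

attribute [instance] MinPres.acg₁ MinPres.acg₀ MinPres.mod₁ MinPres.mod₀

variable {R}
variable {M : Type u} [AddCommGroup M] [Module R M] (pr : MinPres R M)

/-- The map `Hom(P₀, R) → Hom(P₁, R)` dual to `d`, as a map of `Rᵐᵒᵖ`-modules. -/
def MinPres.dualMap : (pr.P₀ →ₗ[R] R) →ₗ[Rᵐᵒᵖ] (pr.P₁ →ₗ[R] R) where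
  toFun g := g.comp pr.d
  map_add' g h := by ext x; simp
  map_smul' s g := by ext x; simp

/-- The transpose `Tr M = Coker (Hom(P₀, R) → Hom(P₁, R))`, an `Rᵐᵒᵖ`-module. -/
def MinPres.Tr : Type u := (pr.P₁ →ₗ[R] R) ⧸ LinearMap.range pr.dualMap

instance : AddCommGroup pr.Tr :=
  inferInstanceAs (AddCommGroup ((pr.P₁ →ₗ[R] R) ⧸ LinearMap.range pr.dualMap))

instance : Module Rᵐᵒᵖ pr.Tr :=
  inferInstanceAs (Module Rᵐᵒᵖ ((pr.P₁ →ₗ[R] R) ⧸ LinearMap.range pr.dualMap))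

/-- The canonical projection onto the transpose. -/
def MinPres.toTr (h : pr.P₁ →ₗ[R] R) : pr.Tr :=
  Submodule.Quotient.mk (p := LinearMap.range pr.dualMap) h

section TauDef

variable (K : Type u) [Field K] [Algebra K R]

instance : Module K pr.Tr :=
  inferInstanceAs (Module K ((pr.P₁ →ₗ[R] R) ⧸ LinearMap.range pr.dualMap))

instance : IsScalarTower K Rᵐᵒᵖ pr.Tr :=
  inferInstanceAs
    (IsScalarTower K Rᵐᵒᵖ ((pr.P₁ →ₗ[R] R) ⧸ LinearMap.range pr.dualMap))

/-- The Auslander–Reiten translate `τM = D (Tr M)`, an `R`-module. -/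
def MinPres.tau : Type u := OpDual R K pr.Tr

instance : AddCommGroup (pr.tau K) := inferInstanceAs (AddCommGroup (OpDual R K pr.Tr))

instance : Module R (pr.tau K) := inferInstanceAs (Module R (OpDual R K pr.Tr))

instance : Module K (pr.tau K) := inferInstanceAs (Module K (OpDual R K pr.Tr))

instance : IsScalarTower K R (pr.tau K) :=
  inferInstanceAs (IsScalarTower K R (OpDual R K pr.Tr))

end TauDef

end MinPres

section Tau

variable (R : Type u) [Ring R] (K : Type u) [Field K] [Algebra K R]

/-- `M` is τ-rigid: `Hom(M, τM) = 0`. -/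
def IsTauRigid (M : Type u) [AddCommGroup M] [Module R M] : Prop :=
  ∀ pr : MinPres R M, ∀ f : M →ₗ[R] pr.tau K, f = 0

/-- `N ∈ ⊥(τM)`, i.e. `Hom(N, τM) = 0`. -/
def InPerpTau (M : Type u) [AddCommGroup M] [Module R M]
    (N : Type u) [AddCommGroup N] [Module R N] : Prop :=
  ∀ pr : MinPres R M, ∀ f : N →ₗ[R] pr.tau K, f = 0

/-- `M` is a τ-tilting module: τ-rigid with `|M| = |R|`. -/
def IsTauTilting (M : Type u) [AddCommGroup M] [Module R M] : Prop :=
  IsTauRigid R K M ∧ ∃ m l : ℕ, NumIndec R M m ∧ NumIndec R R l ∧ m = l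

/-- `M` is τ⁻¹-rigid: `Hom(τ⁻¹M, M) = 0`, where `τ⁻¹M = Tr (D M)`.
A homomorphism `τ⁻¹M → M` is an additive map compatible with the identification
`R ≅ Rᵐᵒᵖᵐᵒᵖ` of scalars. -/
def IsTauInvRigid (M : Type u) [AddCommGroup M] [Module R M] [Module K M]
    [IsScalarTower K R M] : Prop :=
  ∀ pr : MinPres Rᵐᵒᵖ (LDual R K M), ∀ f : pr.Tr →+ M,
    (∀ (r : R) (x : pr.Tr), f (op (op r) • x) = r • f x) → f = 0

/-- `M` is a τ⁻¹-tilting module. -/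
def IsTauInvTilting (M : Type u) [AddCommGroup M] [Module R M] [Module K M]
    [IsScalarTower K R M] : Prop :=
  IsTauInvRigid R K M ∧ ∃ m l : ℕ, NumIndec R M m ∧ NumIndec R R l ∧ m = l

end Tau

section Pairs

variable (K : Type u) [Field K] (R : Type u) [Ring R] [Algebra K R]

/-- A pair `(M, P)` of finitely generated modules (with compatible `K`-structure). -/
structure ModPair : Type (u + 1) where
  M : Type u
  [acgM : AddCommGroup M]
  [modM : Module R M]
  [modKM : Module K M]
  [towM : IsScalarTower K R M]
  finM : Module.Finite R M
  P : Type u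
  [acgP : AddCommGroup P]
  [modP : Module R P]
  [modKP : Module K P]
  [towP : IsScalarTower K R P]
  finP : Module.Finite R P

attribute [instance] ModPair.acgM ModPair.modM ModPair.modKM ModPair.towM
attribute [instance] ModPair.acgP ModPair.modP ModPair.modKP ModPair.towP

variable {K R}

/-- Isomorphism of pairs. -/
def ModPair.Iso (x y : ModPair K R) : Prop :=
  Nonempty (x.M ≃ₗ[R] y.M) ∧ Nonempty (x.P ≃ₗ[R] y.P)

variable (K R)

/-- The setoid of pairs satisfying a property `Q`, up to isomorphism. -/
def pairSetoid (Q : ModPair K R → Prop) : Setoid {x : ModPair K R // Q x} where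
  r a b := ModPair.Iso a.1 b.1
  iseqv := by
    constructor
    · exact fun a => ⟨⟨LinearEquiv.refl R a.1.M⟩, ⟨LinearEquiv.refl R a.1.P⟩⟩
    · rintro a b ⟨⟨e⟩, ⟨e'⟩⟩; exact ⟨⟨e.symm⟩, ⟨e'.symm⟩⟩
    · rintro a b c ⟨⟨e⟩, ⟨e'⟩⟩ ⟨⟨f⟩, ⟨f'⟩⟩; exact ⟨⟨e.trans f⟩, ⟨e'.trans f'⟩⟩

/-- `(M, P)` is a τ-rigid pair: `M` is τ-rigid, `P` is projective and `Hom(P, M) = 0`. -/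
def IsTauRigidPair (x : ModPair K R) : Prop :=
  IsTauRigid R K x.M ∧ Module.Projective R x.P ∧ ∀ f : x.P →ₗ[R] x.M, f = 0

/-- A Gorenstein projective τ-rigid pair. -/
def IsGPTauRigidPair (x : ModPair K R) : Prop :=
  IsTauRigidPair K R x ∧ IsGP R x.M

/-- A support τ-tilting pair: a τ-rigid pair with `|M| + |P| = |R|`. -/
def IsSuppTauTiltingPair (x : ModPair K R) : Prop :=
  IsTauRigidPair K R x ∧
    ∃ m p l : ℕ, NumIndec R x.M m ∧ NumIndec R x.P p ∧ NumIndec R R l ∧ m + p = l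

/-- A Gorenstein projective support τ-tilting pair. -/
def IsGPSuppTauTiltingPair (x : ModPair K R) : Prop :=
  IsSuppTauTiltingPair K R x ∧ IsGP R x.M

/-- `(I, N)` is a τ⁻¹-rigid pair; here `x.M = N` is the module and `x.P = I` is
injective, with `Hom(N, I) = 0`. -/
def IsTauInvRigidPair (x : ModPair K R) : Prop :=
  IsTauInvRigid R K x.M ∧ Module.Injective R x.P ∧ ∀ f : x.M →ₗ[R] x.P, f = 0

/-- A Gorenstein injective τ⁻¹-rigid pair. -/
def IsGITauInvRigidPair (x : ModPair K R) : Prop :=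
  IsTauInvRigidPair K R x ∧ IsGI R K x.M

/-- A support τ⁻¹-tilting pair: a τ⁻¹-rigid pair with `|N| + |I| = |R|`. -/
def IsSuppTauInvTiltingPair (x : ModPair K R) : Prop :=
  IsTauInvRigidPair K R x ∧
    ∃ m p l : ℕ, NumIndec R x.M m ∧ NumIndec R x.P p ∧ NumIndec R R l ∧ m + p = l

/-- A Gorenstein injective support τ⁻¹-tilting pair. -/
def IsGISuppTauInvTiltingPair (x : ModPair K R) : Prop :=
  IsSuppTauInvTiltingPair K R x ∧ IsGI R K x.M

/-- A basic pair. -/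
def IsBasicPair (x : ModPair K R) : Prop := IsBasic R x.M ∧ IsBasic R x.P

/-- `y` is (a representative of) the dagger `(M, P)† = (Tr M_np ⊕ P*, M_p*)` of `x`,
where `M = M_p ⊕ M_np` with `M_p` a maximal projective direct summand. -/
def IsDaggerOf (x : ModPair K R) (y : ModPair K Rᵐᵒᵖ) : Prop :=
  ∃ Mp Mnp : Submodule R x.M, IsCompl Mp Mnp ∧ Module.Projective R Mp ∧
    NoProjSummand R Mnp ∧
    ∃ pr : MinPres R Mnp,
      Nonempty (y.M ≃ₗ[Rᵐᵒᵖ] (pr.Tr × (x.P →ₗ[R] R))) ∧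
      Nonempty (y.P ≃ₗ[Rᵐᵒᵖ] (Mp →ₗ[R] R))

/-- `y` is (a representative of) `D((M, P)†)`, the Gorenstein injective pair
`(D(M_p*), D(Tr M_np ⊕ P*))` associated to `x`; in our convention `y.M` is the
τ⁻¹-rigid module `D(Tr M_np ⊕ P*)` and `y.P` is the injective module `D(M_p*)`. -/
def IsDDaggerOf (x : ModPair K R) (y : ModPair K R) : Prop :=
  ∃ z : ModPair K Rᵐᵒᵖ, IsDaggerOf K R x z ∧
    Nonempty (y.M ≃ₗ[R] OpDual R K z.M) ∧ Nonempty (y.P ≃ₗ[R] OpDual R K z.P)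

end Pairs

section Support

variable (R : Type u) [Ring R] (K : Type u) [Field K] [Algebra K R]

/-- `φ : R →+* S` realizes `S` as the quotient of `R` by the two-sided ideal
generated by `e` (universal property). -/
def IsQuotientByIdem (e : R) (S : Type u) [Ring S] (φ : R →+* S) : Prop :=
  Function.Surjective φ ∧ φ e = 0 ∧
    ∀ (S' : Type u) (_ : Ring S') (ψ : R →+* S'), ψ e = 0 → ∃ χ : S →+* S', χ.comp φ = ψ

/-- `M` is a support τ-tilting module: `M` is a τ-tilting module over `Λ/(e)` for
some idempotent `e`. -/
def IsSuppTauTilting (M : Type u) [AddCommGroup M] [Module R M] : Prop :=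
  ∃ e : R, IsIdempotentElem e ∧
    ∃ (S : Type u) (_ : Ring S) (_ : Algebra K S) (φ : R →+* S),
      (∀ k : K, φ (algebraMap K R k) = algebraMap K S k) ∧
      IsQuotientByIdem R e S φ ∧
      ∃ _ : Module S M, (∀ (r : R) (m : M), φ r • m = r • m) ∧ IsTauTilting S K M

/-- `M` is a support τ⁻¹-tilting module: `M` is a τ⁻¹-tilting module over `Λ/(e)`
for some idempotent `e`. -/
def IsSuppTauInvTilting (M : Type u) [AddCommGroup M] [Module R M] [Module K M] : Prop :=
  ∃ e : R, IsIdempotentElem e ∧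
    ∃ (S : Type u) (_ : Ring S) (_ : Algebra K S) (φ : R →+* S),
      (∀ k : K, φ (algebraMap K R k) = algebraMap K S k) ∧
      IsQuotientByIdem R e S φ ∧
      ∃ _ : Module S M, (∀ (r : R) (m : M), φ r • m = r • m) ∧
        ∃ _ : IsScalarTower K S M, IsTauInvTilting S K M

end Support

section Torsion

variable (R : Type u) [Ring R]

/-- A class of modules is closed under isomorphism. -/
def RespectsIso (T : ModuleCat.{u} R → Prop) : Prop :=
  ∀ X Y : ModuleCat.{u} R, Nonempty (X ≃ₗ[R] Y) → T X → T Y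

/-- `(T, F)` is a torsion pair in the category of finitely generated `R`-modules. -/
def IsTorsionPair (T F : ModuleCat.{u} R → Prop) : Prop :=
  RespectsIso R T ∧ RespectsIso R F ∧
  (∀ X, T X → Module.Finite R X) ∧ (∀ X, F X → Module.Finite R X) ∧
  (∀ X Y : ModuleCat.{u} R, T X → F Y → ∀ f : X →ₗ[R] Y, f = 0) ∧
  (∀ X : ModuleCat.{u} R, Module.Finite R X →
    ∃ t : Submodule R X, T (ModuleCat.of R t) ∧ F (ModuleCat.of R (X ⧸ t)))

/-- `T` is covariantly finite: every finitely generated module admits a left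
`T`-approximation. -/
def CovariantlyFinite (T : ModuleCat.{u} R → Prop) : Prop :=
  ∀ X : ModuleCat.{u} R, Module.Finite R X →
    ∃ (M : ModuleCat.{u} R) (f : X →ₗ[R] M), T M ∧
      ∀ (M' : ModuleCat.{u} R) (g : X →ₗ[R] M'), T M' → ∃ h : M →ₗ[R] M', h.comp f = g

/-- `T` is contravariantly finite: every finitely generated module admits a right
`T`-approximation. -/
def ContravariantlyFinite (T : ModuleCat.{u} R → Prop) : Prop :=
  ∀ X : ModuleCat.{u} R, Module.Finite R X →
    ∃ (M : ModuleCat.{u} R) (f : M →ₗ[R] X), T M ∧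
      ∀ (M' : ModuleCat.{u} R) (g : M' →ₗ[R] X), T M' → ∃ h : M' →ₗ[R] M, f.comp h = g

/-- A functorially finite class. -/
def FunctoriallyFinite (T : ModuleCat.{u} R → Prop) : Prop :=
  CovariantlyFinite R T ∧ ContravariantlyFinite R T

/-- `G` is the basic Ext-projective generator of the torsion class `T`:
`G ∈ T` is basic, Ext-projective in `T`, `T = Fac G`, and every Ext-projective
module in `T` lies in `add G`. -/
def IsBasicExtProjGen (T : ModuleCat.{u} R → Prop) (G : ModuleCat.{u} R) : Prop :=
  T G ∧ IsBasic R G ∧ (∀ X : ModuleCat.{u} R, T X → Ext1Vanishes R G X) ∧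
  (∀ X : ModuleCat.{u} R, T X ↔ (Module.Finite R X ∧ FacOf R G X)) ∧
  (∀ X : ModuleCat.{u} R, T X → (∀ Y : ModuleCat.{u} R, T Y → Ext1Vanishes R X Y) →
    InAdd R G X)

/-- `C` is the basic Ext-injective cogenerator of the torsion-free class `F`:
`C ∈ F` is basic, Ext-injective in `F`, `F = Sub C`, and every Ext-injective
module in `F` lies in `add C`. -/
def IsBasicExtInjCogen (F : ModuleCat.{u} R → Prop) (C : ModuleCat.{u} R) : Prop :=
  F C ∧ IsBasic R C ∧ (∀ X : ModuleCat.{u} R, F X → Ext1Vanishes R X C) ∧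
  (∀ X : ModuleCat.{u} R, F X ↔ (Module.Finite R X ∧ SubOf R C X)) ∧
  (∀ X : ModuleCat.{u} R, F X → (∀ Y : ModuleCat.{u} R, F Y → Ext1Vanishes R Y X) →
    InAdd R C X)

variable (K : Type u) [Field K] [Algebra K R]

/-- A (functorially finite) Gorenstein torsion pair: the basic Ext-projective
generator of `T` is Gorenstein projective. -/
def IsGorensteinTP (T F : ModuleCat.{u} R → Prop) : Prop :=
  IsTorsionPair R T F ∧ FunctoriallyFinite R T ∧
    ∀ G : ModuleCat.{u} R, IsBasicExtProjGen R T G → IsGP R G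

/-- A trivial torsion pair: the basic Ext-projective generator of `T` is projective. -/
def IsTrivialTP (T F : ModuleCat.{u} R → Prop) : Prop :=
  IsTorsionPair R T F ∧ FunctoriallyFinite R T ∧
    ∀ G : ModuleCat.{u} R, IsBasicExtProjGen R T G → Module.Projective R G

end Torsion

section Misc

variable (R : Type u) [Ring R] (K : Type u) [Field K] [Algebra K R]

/-- A projective cover `π : P → M`. -/
structure ProjCover (M : Type u) [AddCommGroup M] [Module R M] : Type (u + 1) where
  P : Type u
  [acg : AddCommGroup P]
  [mod : Module R P]
  fin : Module.Finite R P
  proj : Module.Projective R P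
  π : P →ₗ[R] M
  surj : Function.Surjective π
  min : IsSuperfluous R (LinearMap.ker π)

attribute [instance] ProjCover.acg ProjCover.mod

/-- The canonical evaluation map `M → M** = Hom_{Rᵐᵒᵖ}(Hom_R(M, R), Rᵐᵒᵖ)`. -/
def bidualEval (M : Type u) [AddCommGroup M] [Module R M] (m : M) :
    (M →ₗ[R] R) →ₗ[Rᵐᵒᵖ] Rᵐᵒᵖ where
  toFun f := op (f m)
  map_add' f g := by simp
  map_smul' s f := rfl

/-- `R` is CM-τ-tilting finite: up to isomorphism there are only finitely many
indecomposable Gorenstein projective τ-rigid modules. -/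
def CMTauTiltingFinite : Prop :=
  ∃ (n : ℕ) (V : Fin n → ModuleCat.{u} R),
    ∀ (M : Type u) [AddCommGroup M] [Module R M], Module.Finite R M →
      IsIndec R M → IsGP R M → IsTauRigid R K M → ∃ i, Nonempty (M ≃ₗ[R] V i)

/-- `R` is CM-finite: up to isomorphism there are only finitely many
indecomposable Gorenstein projective modules. -/
def CMFinite : Prop :=
  ∃ (n : ℕ) (V : Fin n → ModuleCat.{u} R),
    ∀ (M : Type u) [AddCommGroup M] [Module R M], Module.Finite R M →
      IsIndec R M → IsGP R M → ∃ i, Nonempty (M ≃ₗ[R] V i)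

/-- `T` is the Bongartz completion of the τ-rigid module `M`: the basic
Ext-projective generator of `⊥(τM)`, with `⊥(τM) = Fac T`. -/
def IsBongartzCompletion (M : Type u) [AddCommGroup M] [Module R M]
    (T : Type u) [AddCommGroup T] [Module R T] : Prop :=
  Module.Finite R T ∧ IsBasic R T ∧ InPerpTau R K M T ∧
  (∀ (X : Type u) [AddCommGroup X] [Module R X], Module.Finite R X →
    InPerpTau R K M X → Ext1Vanishes R T X) ∧
  (∀ (X : Type u) [AddCommGroup X] [Module R X], Module.Finite R X →
    (InPerpTau R K M X ↔ FacOf R T X))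

end Misc

section Superfluous

variable {A : Type u} [Ring A]

lemma IsSuperfluous.map {M M' : Type u} [AddCommGroup M] [Module A M] [AddCommGroup M']
    [Module A M'] {N : Submodule A M} (h : IsSuperfluous A N) (f : M →ₗ[A] M') :
    IsSuperfluous A (N.map f) := by
  intro N' hN'
  have h1 : N ⊔ N'.comap f = ⊤ := by
    rw [eq_top_iff]
    intro x _
    have hx : f x ∈ N.map f ⊔ N' := hN' ▸ Submodule.mem_top
    obtain ⟨_, ⟨y, hy, rfl⟩, z, hz, hyz⟩ := Submodule.mem_sup.1 hx
    refine Submodule.mem_sup.2 ⟨y, hy, x - y, ?_, by abel⟩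
    simpa [← hyz] using hz
  have h2 := h _ h1
  have h3 : N.map f ≤ N' := by
    rintro _ ⟨y, -, rfl⟩
    exact (h2 ▸ Submodule.mem_top : y ∈ N'.comap f)
  rwa [sup_eq_right.2 h3] at hN'

lemma IsSuperfluous.sup {M : Type u} [AddCommGroup M] [Module A M] {N₁ N₂ : Submodule A M}
    (h₁ : IsSuperfluous A N₁) (h₂ : IsSuperfluous A N₂) : IsSuperfluous A (N₁ ⊔ N₂) :=
  fun N' h => h₂ _ (h₁ _ (by rwa [← sup_assoc]))

lemma IsSuperfluous.bot {M : Type u} [AddCommGroup M] [Module A M] :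
    IsSuperfluous A (⊥ : Submodule A M) := fun N' h => by simpa using h

lemma IsSuperfluous.pi {ι : Type} [Finite ι] {M : ι → Type u} [∀ i, AddCommGroup (M i)]
    [∀ i, Module A (M i)] {N : ∀ i, Submodule A (M i)} (h : ∀ i, IsSuperfluous A (N i)) :
    IsSuperfluous A (Submodule.pi Set.univ N) := by
  classical
  have := Fintype.ofFinite ι
  rw [← Submodule.iSup_map_single, ← Finset.sup_univ_eq_iSup]
  exact Finset.sup_induction IsSuperfluous.bot (fun _ h₁ _ h₂ => h₁.sup h₂)
    fun i _ => (h i).map _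

lemma IsSuperfluous.of_equiv {M M' : Type u} [AddCommGroup M] [Module A M] [AddCommGroup M']
    [Module A M'] {N : Submodule A M} (h : IsSuperfluous A N) (e : M ≃ₗ[A] M')
    {N' : Submodule A M'} (hN : ∀ x, x ∈ N ↔ e x ∈ N') : IsSuperfluous A N' := by
  have : N' = N.map e.toLinearMap := by
    ext y
    constructor
    · exact fun hy => ⟨e.symm y, (hN _).2 (by simpa using hy), by simp⟩
    · rintro ⟨x, hx, rfl⟩
      exact (hN x).1 hx
  exact this ▸ h.map _

/-- A linear map into a projective module has superfluous range as soon as all the perturbations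
`1 - f ∘ h` of the identity are surjective. -/
lemma isSuperfluous_range_of_surjective {P Q : Type u} [AddCommGroup P] [Module A P]
    [AddCommGroup Q] [Module A Q] [Module.Projective A Q] (f : P →ₗ[A] Q)
    (h : ∀ g : Q →ₗ[A] P, Surjective (LinearMap.id - f ∘ₗ g : Q →ₗ[A] Q)) :
    IsSuperfluous A (LinearMap.range f) := by
  intro N hN
  have hs : Surjective (N.mkQ ∘ₗ f) := by
    intro y
    obtain ⟨x, rfl⟩ := N.mkQ_surjective y
    have hx : x ∈ LinearMap.range f ⊔ N := hN ▸ Submodule.mem_top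
    obtain ⟨_, ⟨p, rfl⟩, z, hz, rfl⟩ := Submodule.mem_sup.1 hx
    exact ⟨p, by simp [(Submodule.Quotient.mk_eq_zero N).2 hz]⟩
  obtain ⟨g, hg⟩ := Module.projective_lifting_property _ N.mkQ hs
  rw [eq_top_iff]
  intro y _
  obtain ⟨x, rfl⟩ := h g y
  rw [← Submodule.Quotient.mk_eq_zero, ← Submodule.mkQ_apply, LinearMap.sub_apply, map_sub,
    sub_eq_zero]
  exact (LinearMap.congr_fun hg x).symm

lemma IsSuperfluous.surjective_id_sub {P Q : Type u} [AddCommGroup P] [Module A P]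
    [AddCommGroup Q] [Module A Q] {f : P →ₗ[A] Q} (h : IsSuperfluous A (LinearMap.range f))
    (g : Q →ₗ[A] P) : Surjective (LinearMap.id - f ∘ₗ g : Q →ₗ[A] Q) := by
  rw [← LinearMap.range_eq_top]
  refine h _ (eq_top_iff.2 fun x _ => Submodule.mem_sup.2 ⟨f (g x), ⟨_, rfl⟩, x - f (g x),
    ⟨x, rfl⟩, by abel⟩)

/-- A linear map whose composite with a map with superfluous kernel is surjective, is
surjective. -/
lemma IsSuperfluous.surjective_of_comp {P Q X : Type u} [AddCommGroup P] [Module A P]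
    [AddCommGroup Q] [Module A Q] [AddCommGroup X] [Module A X] {p : Q →ₗ[A] X}
    (h : IsSuperfluous A (LinearMap.ker p)) (g : P →ₗ[A] Q)
    (hg : ∀ y, ∃ x, p (g x) = p y) : Surjective g := by
  rw [← LinearMap.range_eq_top]
  refine h _ (eq_top_iff.2 fun y _ => ?_)
  obtain ⟨x, hx⟩ := hg y
  exact Submodule.mem_sup.2 ⟨y - g x, by simp [hx], g x, ⟨x, rfl⟩, by abel⟩

lemma exists_lift_of_range_le {P Q X : Type u} [AddCommGroup P] [Module A P]
    [AddCommGroup Q] [Module A Q] [AddCommGroup X] [Module A X] [Module.Projective A P]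
    (f : P →ₗ[A] X) (g : Q →ₗ[A] X) (h : ∀ x, ∃ y, g y = f x) :
    ∃ u : P →ₗ[A] Q, ∀ x, g (u x) = f x := by
  obtain ⟨u, hu⟩ := Module.projective_lifting_property g.rangeRestrict
    (f.codRestrict (LinearMap.range g) h) g.surjective_rangeRestrict
  exact ⟨u, fun x => congrArg Subtype.val (LinearMap.congr_fun hu x)⟩

/-- Uniqueness of projective covers. -/
lemma exists_equiv_of_isSuperfluous_ker [IsNoetherianRing A] {P Q X : Type u} [AddCommGroup P]
    [Module A P] [AddCommGroup Q] [Module A Q] [AddCommGroup X] [Module A X]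
    [Module.Projective A P] [Module.Projective A Q] [Module.Finite A P]
    {f : P →ₗ[A] X} {g : Q →ₗ[A] X} (hf : IsSuperfluous A (LinearMap.ker f))
    (hg : IsSuperfluous A (LinearMap.ker g)) (h : LinearMap.range f = LinearMap.range g) :
    ∃ e : P ≃ₗ[A] Q, ∀ x, g (e x) = f x := by
  obtain ⟨u, hu⟩ := exists_lift_of_range_le f g fun x =>
    LinearMap.mem_range.1 (h.le (LinearMap.mem_range_self f x))
  obtain ⟨v, hv⟩ := exists_lift_of_range_le g f fun x =>
    LinearMap.mem_range.1 (h.ge (LinearMap.mem_range_self g x))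
  have hus : Surjective u := hg.surjective_of_comp u fun y => ⟨v y, by rw [hu, hv]⟩
  have hvs : Surjective v := hf.surjective_of_comp v fun y => ⟨u y, by rw [hv, hu]⟩
  have hi := IsNoetherian.injective_of_surjective_endomorphism (v ∘ₗ u) (hvs.comp hus)
  exact ⟨LinearEquiv.ofBijective u ⟨Injective.of_comp hi, hus⟩, hu⟩

/-- Fitting's lemma in the form used below: either `1 - x` is injective, or `x` restricts to an
automorphism of a nonzero direct summand. -/
lemma exists_fitting [IsNoetherianRing A] [IsArtinianRing A] {M : Type u} [AddCommGroup M]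
    [Module A M] [Module.Finite A M] (x : Module.End A M) :
    ∃ n : ℕ, 0 < n ∧ IsCompl (LinearMap.ker (x ^ n)) (LinearMap.range (x ^ n)) := by
  obtain ⟨n, hn⟩ := Filter.eventually_atTop.1 (LinearMap.eventually_isCompl_ker_pow_range_pow x)
  exact ⟨n + 1, n.succ_pos, hn _ n.le_succ⟩

/-- Over a module without projective direct summands, an endomorphism `f` factoring through a
projective module is such that `1 - f` is injective. -/
lemma NoProjSummand.injective_one_sub [IsNoetherianRing A] [IsArtinianRing A] {M F : Type u}
    [AddCommGroup M] [Module A M] [Module.Finite A M] [AddCommGroup F] [Module A F]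
    [Module.Projective A F] (h : NoProjSummand A M) (a : M →ₗ[A] F) (b : F →ₗ[A] M) :
    Injective (1 - (b ∘ₗ a : Module.End A M) : Module.End A M) := by
  set x : Module.End A M := 1 - (b ∘ₗ a : Module.End A M) with hx
  obtain ⟨n, hn, hc⟩ := exists_fitting x
  have key : ∀ m, x m = 0 → (x ^ n) m = 0 := by
    intro m hm
    obtain ⟨k, rfl⟩ := Nat.exists_eq_succ_of_ne_zero hn.ne'
    rw [pow_succ, Module.End.mul_apply, hm, map_zero]
  have hbot : LinearMap.ker (x ^ n) = ⊥ := by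
    refine h _ _ hc ?_
    let s : Module.End A M := ∑ i ∈ Finset.range n, x ^ i
    have hs : (b ∘ₗ a : Module.End A M) * s = 1 - x ^ n := by
      have := mul_neg_geom_sum x n
      rwa [hx, sub_sub_cancel, ← hx] at this
    refine Module.Projective.of_split (M := F)
      (a ∘ₗ s ∘ₗ (LinearMap.ker (x ^ n)).subtype)
      ((Submodule.projectionOnto _ _ hc) ∘ₗ b) ?_
    ext1 m
    have h1 : b (a (s m)) = m := by
      have := LinearMap.congr_fun hs (m : M)
      simpa [LinearMap.mem_ker.1 m.2] using this
    simp [h1]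
  rw [← LinearMap.ker_eq_bot, eq_bot_iff]
  intro m hm
  exact hbot ▸ (LinearMap.mem_ker.2 (key m hm))

/-- Every finitely generated module over an artinian ring has a projective cover. -/
lemma exists_projCover [IsNoetherianRing A] [IsArtinianRing A] (M : Type u) [AddCommGroup M]
    [Module A M] [Module.Finite A M] :
    ∃ (P : Type u) (_ : AddCommGroup P) (_ : Module A P) (p : P →ₗ[A] M),
      Module.Finite A P ∧ Module.Projective A P ∧ Surjective p ∧
      IsSuperfluous A (LinearMap.ker p) := by
  obtain ⟨n, f, hf⟩ := Module.Finite.exists_fin' A M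
  obtain ⟨P, ⟨⟨C, hC⟩, hP⟩, hmin⟩ := IsArtinian.set_has_minimal
    {P : Submodule A (Fin n → A) | (∃ C, IsCompl P C) ∧ Surjective (f ∘ₗ P.subtype)}
    ⟨⊤, ⟨⊥, isCompl_top_bot⟩, fun m => by
      obtain ⟨x, rfl⟩ := hf m; exact ⟨⟨x, trivial⟩, rfl⟩⟩
  have hproj : Module.Projective A P := Module.Projective.of_split P.subtype
    (Submodule.projectionOnto P C hC) (by ext1; simp)
  refine ⟨P, inferInstance, inferInstance, f ∘ₗ P.subtype, inferInstance, hproj, hP, ?_⟩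
  intro N hN
  obtain ⟨g, hg⟩ := exists_lift_of_range_le (f ∘ₗ P.subtype) (f ∘ₗ P.subtype ∘ₗ N.subtype) <| by
    intro x
    have hx : x ∈ LinearMap.ker (f ∘ₗ P.subtype) ⊔ N := hN ▸ Submodule.mem_top
    obtain ⟨y, hy, z, hz, rfl⟩ := Submodule.mem_sup.1 hx
    refine ⟨⟨z, hz⟩, ?_⟩
    rw [map_add, LinearMap.mem_ker.1 hy, zero_add]
    rfl
  let x : Module.End A P := N.subtype ∘ₗ g
  have hxf : ∀ y, f (x y) = f y := hg
  obtain ⟨k, hk, hc⟩ := exists_fitting x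
  have hxk : ∀ y, f ((x ^ k) y : P) = f y := by
    intro y
    clear hk hc
    induction k generalizing y with
    | zero => rfl
    | succ k ih => rw [pow_succ, Module.End.mul_apply, ih, hxf]
  have hle : LinearMap.range (x ^ k) ≤ N := by
    obtain ⟨k, rfl⟩ := Nat.exists_eq_succ_of_ne_zero hk.ne'
    rintro _ ⟨y, rfl⟩
    rw [pow_succ', Module.End.mul_apply]
    exact (g _).2
  have hmem : (LinearMap.range (x ^ k)).map P.subtype ∈
      {P : Submodule A (Fin n → A) | (∃ C, IsCompl P C) ∧ Surjective (f ∘ₗ P.subtype)} := by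
    refine ⟨?_, fun m => ?_⟩
    · let t : (Fin n → A) →ₗ[A] (LinearMap.range (x ^ k)).map P.subtype :=
        (P.equivSubtypeMap (LinearMap.range (x ^ k))).toLinearMap ∘ₗ
          Submodule.projectionOnto _ _ hc.symm ∘ₗ Submodule.projectionOnto P C hC
      refine ⟨LinearMap.ker t, LinearMap.isCompl_of_proj ?_⟩
      rintro ⟨_, ⟨y, hy, rfl⟩⟩
      have h1 : Submodule.projectionOnto P C hC y = y := by simp
      have h2 : Submodule.projectionOnto _ _ hc.symm y = ⟨y, hy⟩ :=
        Submodule.projectionOnto_apply_left _ ⟨y, hy⟩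
      simp only [t, LinearMap.comp_apply, Submodule.subtype_apply, h1, h2]
      rfl
    · obtain ⟨y, rfl⟩ := hP m
      exact ⟨⟨_, ⟨(x ^ k) y, ⟨y, rfl⟩, rfl⟩⟩, hxk y⟩
  have hnl := hmin _ hmem
  have hle' : (LinearMap.range (x ^ k)).map P.subtype ≤ P := Submodule.map_subtype_le _ _
  have heq := eq_of_le_of_not_lt hle' hnl
  rw [eq_top_iff]
  intro y _
  have hy : (y : Fin n → A) ∈ (LinearMap.range (x ^ k)).map P.subtype :=
    heq.ge y.2
  obtain ⟨z, hz, hzy⟩ := hy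
  exact hle ((Subtype.ext hzy : z = y) ▸ hz)

/-- Every finitely generated module over an artinian ring has a minimal projective
presentation. -/
lemma exists_minPres [IsNoetherianRing A] [IsArtinianRing A] (M : Type u) [AddCommGroup M]
    [Module A M] [Module.Finite A M] : Nonempty (MinPres A M) := by
  obtain ⟨P₀, _, _, p, hf₀, hp₀, hs₀, hm₀⟩ := exists_projCover (A := A) M
  obtain ⟨P₁, _, _, q, hf₁, hp₁, hs₁, hm₁⟩ := exists_projCover (A := A) (LinearMap.ker p)
  refine ⟨{ P₁ := P₁, P₀ := P₀, fin₁ := hf₁, fin₀ := hf₀, proj₁ := hp₁, proj₀ := hp₀,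
            d := (LinearMap.ker p).subtype ∘ₗ q, p := p, surj := hs₀, exact := ?_,
            min₀ := hm₀, min₁ := ?_ }⟩
  · intro x
    constructor
    · intro hx
      obtain ⟨y, hy⟩ := hs₁ ⟨x, hx⟩
      exact ⟨y, congrArg Subtype.val hy⟩
    · rintro ⟨y, rfl⟩
      exact (q y).2
  · rwa [LinearMap.ker_comp_of_ker_eq_bot _ (Submodule.ker_subtype _)]

end Superfluous

section Dual

variable (A B W : Type u) [Ring A] [Ring B] [AddCommGroup W] [Module A W] [Module B W]

/-- An `A`-`B`-bimodule `W` (both actions written on the left) which is free of rank one on either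
side, with a common generator. The regular bimodule is the main example; the definition is
symmetric in the two rings, so that duality statements need to be proved on one side only. -/
def IsRegularBimodule : Prop :=
  ∃ w : W, Bijective (fun a : A => a • w) ∧ Bijective (fun b : B => b • w)

variable {A B W}

lemma IsRegularBimodule.symm (h : IsRegularBimodule A B W) : IsRegularBimodule B A W := by
  obtain ⟨w, h₁, h₂⟩ := h
  exact ⟨w, h₂, h₁⟩

lemma IsRegularBimodule.exists_equiv (h : IsRegularBimodule A B W) : Nonempty (A ≃ₗ[A] W) := by
  obtain ⟨w, h₁, -⟩ := h
  exact ⟨LinearEquiv.ofBijective (LinearMap.toSpanSingleton A W w) h₁⟩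

lemma isRegularBimodule_op (R : Type u) [Ring R] : IsRegularBimodule R Rᵐᵒᵖ R :=
  ⟨1, by simpa using! bijective_id, by simpa using unop_bijective⟩

variable [SMulCommClass A B W]

variable (A B W) in
/-- Precomposition with `f`, as a map of `B`-modules between `W`-duals. -/
def dmap {M N : Type u} [AddCommGroup M] [Module A M] [AddCommGroup N] [Module A N]
    (f : M →ₗ[A] N) : (N →ₗ[A] W) →ₗ[B] (M →ₗ[A] W) where
  toFun g := g ∘ₗ f
  map_add' _ _ := rfl
  map_smul' _ _ := rfl

@[simp] lemma dmap_apply {M N : Type u} [AddCommGroup M] [Module A M] [AddCommGroup N]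
    [Module A N] (f : M →ₗ[A] N) (g : N →ₗ[A] W) (x : M) : dmap A B W f g x = g (f x) := rfl

/-- The `W`-dual of an isomorphism. -/
def dcongr (B W : Type u) [Ring B] [AddCommGroup W] [Module A W] [Module B W]
    [SMulCommClass A B W] {M N : Type u} [AddCommGroup M] [Module A M] [AddCommGroup N]
    [Module A N] (e : M ≃ₗ[A] N) : (N →ₗ[A] W) ≃ₗ[B] (M →ₗ[A] W) :=
  LinearEquiv.ofLinearMap (dmap A B W e.toLinearMap) (dmap A B W e.symm.toLinearMap)
    (by ext; simp) (by ext; simp)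

/-- Evaluation into the double `W`-dual. -/
def dev (A B W : Type u) [Ring A] [Ring B] [AddCommGroup W] [Module A W] [Module B W]
    [SMulCommClass A B W] [SMulCommClass B A W] (M : Type u) [AddCommGroup M] [Module A M] :
    M →ₗ[A] ((M →ₗ[A] W) →ₗ[B] W) where
  toFun x :=
    { toFun := fun f => f x
      map_add' := fun _ _ => rfl
      map_smul' := fun _ _ => rfl }
  map_add' x y := by ext f; exact map_add f x y
  map_smul' a x := by ext f; exact map_smul f a x

@[simp] lemma dev_apply [SMulCommClass B A W] {M : Type u} [AddCommGroup M] [Module A M]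
    (x : M) (f : M →ₗ[A] W) :
    dev A B W M x f = f x := rfl

lemma exists_dualBasis (P : Type u) [AddCommGroup P] [Module A P] [Module.Finite A P]
    [Module.Projective A P] : ∃ (n : ℕ) (s : P →ₗ[A] (Fin n → A)) (e : Fin n → P),
      ∀ x, ∑ i, s x i • e i = x := by
  obtain ⟨n, r, hr⟩ := Module.Finite.exists_fin' A P
  obtain ⟨s, hs⟩ := Module.projective_lifting_property r LinearMap.id hr
  refine ⟨n, s, fun i => r (Pi.single i 1), fun x => ?_⟩
  have hx : r (s x) = x := LinearMap.congr_fun hs x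
  conv_rhs => rw [← hx, ← LinearMap.sum_single_apply _ (s x), map_sum]
  simp [← map_smul, ← Pi.single_smul]

/-- The `W`-dual of a finitely generated projective module is finitely generated projective. -/
lemma IsRegularBimodule.dual_finite_projective (h : IsRegularBimodule A B W) (P : Type u)
    [AddCommGroup P] [Module A P] [Module.Finite A P] [Module.Projective A P] :
    Module.Finite B (P →ₗ[A] W) ∧ Module.Projective B (P →ₗ[A] W) := by
  obtain ⟨n, s, e, he⟩ := exists_dualBasis (A := A) P
  obtain ⟨θ⟩ := h.symm.exists_equiv
  have := Module.Finite.equiv θ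
  have := Module.Projective.of_equiv (LinearEquiv.piCongrRight fun _ : Fin n => θ)
  let i : (P →ₗ[A] W) →ₗ[B] (Fin n → W) :=
    { toFun := fun f j => f (e j)
      map_add' := fun _ _ => rfl
      map_smul' := fun _ _ => rfl }
  let r : (Fin n → W) →ₗ[B] (P →ₗ[A] W) :=
    { toFun := fun w =>
        { toFun := fun x => ∑ j, s x j • w j
          map_add' := fun x y => by simp [add_smul, Finset.sum_add_distrib]
          map_smul' := fun a x => by simp [mul_smul, Finset.smul_sum] }
      map_add' := fun v w => by ext x; simp [smul_add, Finset.sum_add_distrib]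
      map_smul' := fun b w => by ext x; simp [Finset.smul_sum, smul_comm] }
  have hri : r ∘ₗ i = LinearMap.id := by
    ext f x
    change ∑ j, s x j • f (e j) = f x
    conv_rhs => rw [← he x]
    simp
  exact ⟨Module.Finite.of_surjective r fun f => ⟨i f, LinearMap.congr_fun hri f⟩,
    Module.Projective.of_split i r hri⟩

/-- Finitely generated projective modules are `W`-reflexive. -/
lemma IsRegularBimodule.dev_bijective [SMulCommClass B A W]
    (h : IsRegularBimodule A B W) (P : Type u)
    [AddCommGroup P] [Module A P] [Module.Finite A P] [Module.Projective A P] :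
    Bijective (dev A B W P) := by
  obtain ⟨n, s, e, he⟩ := exists_dualBasis (A := A) P
  obtain ⟨w, h₁, h₂⟩ := h
  let c : Fin n → P →ₗ[A] W := fun i =>
    LinearMap.toSpanSingleton A W w ∘ₗ LinearMap.proj i ∘ₗ s
  have hc : ∀ i x, c i x = s x i • w := fun _ _ => rfl
  constructor
  · rw [injective_iff_map_eq_zero]
    intro x hx
    have h0 : ∀ i, s x i = 0 := fun i => h₁.1 <| by
      have := LinearMap.congr_fun hx (c i)
      rw [dev_apply, hc, LinearMap.zero_apply] at this
      simpa using this
    rw [← he x]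
    simp [h0]
  · intro φ
    choose a ha using fun i => h₁.2 (φ (c i))
    refine ⟨∑ i, a i • e i, LinearMap.ext fun f => ?_⟩
    choose b hb using fun i => h₂.2 (f (e i))
    dsimp only at ha hb
    have hf : f = ∑ i, b i • c i := by
      ext x
      conv_lhs => rw [← he x]
      rw [map_sum, LinearMap.sum_apply]
      refine Finset.sum_congr rfl fun i _ => ?_
      rw [map_smul, ← hb, LinearMap.smul_apply, hc, smul_comm]
    have h3 : φ f = ∑ i, b i • a i • w := by
      conv_lhs => rw [hf]
      simp [ha]
    rw [h3, dev_apply, map_sum]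
    refine Finset.sum_congr rfl fun i _ => ?_
    rw [map_smul, ← hb, smul_comm]

/-- Every map between duals of finitely generated projective modules is a dual map. -/
lemma IsRegularBimodule.exists_dmap_eq [SMulCommClass B A W]
    (h : IsRegularBimodule A B W) {P Q : Type u}
    [AddCommGroup P] [Module A P] [AddCommGroup Q] [Module A Q] [Module.Finite A Q]
    [Module.Projective A Q] (k : (Q →ₗ[A] W) →ₗ[B] (P →ₗ[A] W)) :
    ∃ g : P →ₗ[A] Q, dmap A B W g = k := by
  let e := LinearEquiv.ofBijective _ (h.dev_bijective Q)
  refine ⟨e.symm.toLinearMap ∘ₗ dmap B A W k ∘ₗ dev A B W P, ?_⟩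
  ext f x
  have h1 : dev A B W Q (e.symm (dmap B A W k (dev A B W P x))) = dmap B A W k (dev A B W P x) :=
    e.apply_symm_apply _
  exact LinearMap.congr_fun h1 f

end Dual

section Transpose

variable (A B W : Type u) [Ring A] [Ring B] [AddCommGroup W] [Module A W] [Module B W]
  [SMulCommClass A B W]

/-- A minimal projective presentation of `M` exhibiting `N` as the transpose of `M`, such that the
dual presentation of `N` is minimal, too. -/
structure TrPres (M N : Type u) [AddCommGroup M] [Module A M] [AddCommGroup N]
    [Module B N] : Type (u + 1) where
  (P₁ P₀ : Type u)
  [acg₁ : AddCommGroup P₁]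
  [acg₀ : AddCommGroup P₀]
  [mod₁ : Module A P₁]
  [mod₀ : Module A P₀]
  [fin₁ : Module.Finite A P₁]
  [fin₀ : Module.Finite A P₀]
  [proj₁ : Module.Projective A P₁]
  [proj₀ : Module.Projective A P₀]
  d : P₁ →ₗ[A] P₀
  p : P₀ →ₗ[A] M
  q : (P₁ →ₗ[A] W) →ₗ[B] N
  surj_p : Surjective p
  exact_p : Exact d p
  surj_q : Surjective q
  exact_q : Exact (dmap A B W d) q
  min_p : IsSuperfluous A (LinearMap.ker p)
  min_d : IsSuperfluous A (LinearMap.ker d)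
  min_dual : IsSuperfluous B (LinearMap.ker (dmap A B W d))

attribute [instance] TrPres.acg₁ TrPres.acg₀ TrPres.mod₁ TrPres.mod₀ TrPres.fin₁ TrPres.fin₀
  TrPres.proj₁ TrPres.proj₀

variable {A B W} {M N : Type u} [AddCommGroup M] [Module A M] [AddCommGroup N] [Module B N]

lemma bijective_one_sub_swap {P Q : Type u} [AddCommGroup P] [Module A P] [AddCommGroup Q]
    [Module A Q] {f : P →ₗ[A] Q} {g : Q →ₗ[A] P}
    (h : Bijective (LinearMap.id - f ∘ₗ g : Q →ₗ[A] Q)) :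
    Bijective (LinearMap.id - g ∘ₗ f : P →ₗ[A] P) := by
  have hx : ∀ y, y - f (g y) = (LinearMap.id - f ∘ₗ g : Q →ₗ[A] Q) y := fun _ => rfl
  constructor
  · rw [injective_iff_map_eq_zero]
    intro x hx0
    have h0 : x = g (f x) := sub_eq_zero.1 hx0
    have : f x = 0 := (injective_iff_map_eq_zero _).1 h.1 (f x) (by
      rw [← hx, ← h0, sub_self])
    rw [h0, this, map_zero]
  · intro x
    obtain ⟨y, hy⟩ := h.2 (f x)
    rw [← hx] at hy
    refine ⟨x + g y, ?_⟩
    have : f (x + g y) = y := by rw [map_add, ← hy]; abel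
    simp [this]

lemma bijective_dmap {P Q : Type u} [AddCommGroup P] [Module A P] [AddCommGroup Q]
    [Module A Q] {f : P →ₗ[A] Q} (h : Bijective f) : Bijective (dmap A B W f) :=
  (dcongr B W (LinearEquiv.ofBijective f h)).bijective

/-- The dual of a radical map between projective modules is radical. -/
lemma IsSuperfluous.range_dmap [IsNoetherianRing A] [SMulCommClass B A W]
    (hW : IsRegularBimodule A B W) {P Q : Type u} [AddCommGroup P] [Module A P] [AddCommGroup Q]
    [Module A Q] [Module.Finite A P] [Module.Projective A P] [Module.Finite A Q]
    [Module.Projective A Q] {d : P →ₗ[A] Q} (h : IsSuperfluous A (LinearMap.range d)) :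
    IsSuperfluous B (LinearMap.range (dmap A B W d)) := by
  have := (hW.dual_finite_projective P).2
  refine isSuperfluous_range_of_surjective _ fun k => ?_
  obtain ⟨g, rfl⟩ := hW.exists_dmap_eq k
  have h1 := h.surjective_id_sub g
  have h2 := IsNoetherian.injective_of_surjective_endomorphism _ h1
  intro f
  obtain ⟨f', rfl⟩ := (bijective_dmap (B := B) (W := W) (bijective_one_sub_swap ⟨h2, h1⟩)).2 f
  exact ⟨f', by ext; simp⟩

/-- Presentations exhibiting a transpose can be dualized. -/
lemma TrPres.nonempty_swap [SMulCommClass B A W] [IsNoetherianRing A]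
    (hW : IsRegularBimodule A B W)
    (T : TrPres A B W M N) : Nonempty (TrPres B A W N M) := by
  obtain ⟨f₀, p₀⟩ := hW.dual_finite_projective T.P₀
  obtain ⟨f₁, p₁⟩ := hW.dual_finite_projective T.P₁
  let e₀ := LinearEquiv.ofBijective _ (hW.dev_bijective T.P₀)
  let e₁ := LinearEquiv.ofBijective _ (hW.dev_bijective T.P₁)
  have hnat : ∀ x, dmap B A W (dmap A B W T.d) (e₁ x) = e₀ (T.d x) := fun x => rfl
  have hp : LinearMap.range T.d = LinearMap.ker T.p :=
    (LinearMap.exact_iff.1 T.exact_p).symm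
  have hq : LinearMap.range (dmap A B W T.d) = LinearMap.ker T.q :=
    (LinearMap.exact_iff.1 T.exact_q).symm
  refine ⟨{
    P₁ := T.P₀ →ₗ[A] W
    P₀ := T.P₁ →ₗ[A] W
    d := dmap A B W T.d
    p := T.q
    q := T.p ∘ₗ e₀.symm.toLinearMap
    surj_p := T.surj_q
    exact_p := T.exact_q
    surj_q := T.surj_p.comp e₀.symm.surjective
    exact_q := ?_
    min_p := hq ▸ (hp.symm ▸ T.min_p : IsSuperfluous A (LinearMap.range T.d)).range_dmap hW
    min_d := T.min_dual
    min_dual := T.min_d.of_equiv e₁ fun x => ?_ }⟩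
  · intro y
    obtain ⟨y, rfl⟩ := e₀.surjective y
    rw [LinearMap.comp_apply, LinearEquiv.coe_coe, e₀.symm_apply_apply, T.exact_p y]
    constructor
    · rintro ⟨x, rfl⟩
      exact ⟨e₁ x, hnat x⟩
    · rintro ⟨z, hz⟩
      obtain ⟨x, rfl⟩ := e₁.surjective z
      exact ⟨x, e₀.injective (by rw [← hnat, hz])⟩
  · rw [LinearMap.mem_ker, LinearMap.mem_ker, hnat, LinearEquiv.map_eq_zero_iff]

/-- The transpose does not depend on the choice of the minimal presentation, nor on the regular
bimodule used to define it. -/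
lemma TrPres.exists_addEquiv [IsNoetherianRing A] {B' W' : Type u} [Ring B'] [AddCommGroup W']
    [Module A W'] [Module B' W'] [SMulCommClass A B' W']
    {M' N' : Type u} [AddCommGroup M'] [Module A M'] [AddCommGroup N'] [Module B' N']
    (T : TrPres A B W M N) {P₁ P₀ : Type u} [AddCommGroup P₁] [Module A P₁] [AddCommGroup P₀]
    [Module A P₀] [Module.Projective A P₁] [Module.Projective A P₀]
    {d : P₁ →ₗ[A] P₀} {p : P₀ →ₗ[A] M'} {q : (P₁ →ₗ[A] W') →ₗ[B'] N'} (hp : Surjective p)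
    (hdp : Exact d p) (hq : Surjective q) (hdq : Exact (dmap A B' W' d) q)
    (hmp : IsSuperfluous A (LinearMap.ker p)) (hmd : IsSuperfluous A (LinearMap.ker d))
    (e : M ≃ₗ[A] M') (σ : B → B') (θ : W ≃ₗ[A] W') (hθ : ∀ b w, θ (b • w) = σ b • θ w) :
    ∃ ε : N ≃+ N', ∀ b n, ε (b • n) = σ b • ε n := by
  have he : LinearMap.ker (e.toLinearMap ∘ₗ T.p) = LinearMap.ker T.p :=
    LinearMap.ker_comp_of_ker_eq_bot _ e.ker
  obtain ⟨u₀, hu₀⟩ := exists_equiv_of_isSuperfluous_ker (f := e.toLinearMap ∘ₗ T.p) (g := p)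
    (he ▸ T.min_p) hmp (by
      rw [LinearMap.range_eq_top.2 hp, LinearMap.range_comp_of_range_eq_top _ (LinearMap.range_eq_top.2 T.surj_p),
        LinearEquiv.range])
  have hu₀' : ∀ x, T.p x = 0 ↔ p (u₀ x) = 0 := fun x => by
    rw [hu₀, LinearMap.comp_apply, LinearEquiv.coe_coe, LinearEquiv.map_eq_zero_iff]
  obtain ⟨u₁, hu₁⟩ := exists_equiv_of_isSuperfluous_ker (f := u₀.toLinearMap ∘ₗ T.d) (g := d)
    (LinearMap.ker_comp_of_ker_eq_bot T.d u₀.ker ▸ T.min_d) hmd (by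
      ext y
      obtain ⟨x, rfl⟩ := u₀.surjective y
      rw [LinearMap.mem_range, LinearMap.mem_range]
      refine Iff.trans ?_ ((T.exact_p x).symm.trans ((hu₀' x).trans (hdp _)))
      simp)
  simp only [LinearMap.comp_apply, LinearEquiv.coe_coe] at hu₁
  let E : (T.P₁ →ₗ[A] W) ≃+ (P₁ →ₗ[A] W') :=
    { toFun := fun f => θ.toLinearMap ∘ₗ f ∘ₗ u₁.symm.toLinearMap
      invFun := fun f => θ.symm.toLinearMap ∘ₗ f ∘ₗ u₁.toLinearMap
      left_inv := fun f => by ext; simp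
      right_inv := fun f => by ext; simp
      map_add' := fun f g => by ext; simp }
  have hE : ∀ f x, E f x = θ (f (u₁.symm x)) := fun _ _ => rfl
  have hk : ∀ f, T.q f = 0 ↔ q (E f) = 0 := by
    intro f
    rw [T.exact_q f, hdq (E f)]
    constructor
    · rintro ⟨g, rfl⟩
      refine ⟨θ.toLinearMap ∘ₗ g ∘ₗ u₀.symm.toLinearMap, ?_⟩
      ext x
      obtain ⟨x, rfl⟩ := u₁.surjective x
      simp [hE, hu₁]
    · rintro ⟨g, hg⟩
      refine ⟨θ.symm.toLinearMap ∘ₗ g ∘ₗ u₀.toLinearMap, ?_⟩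
      ext x
      have := LinearMap.congr_fun hg (u₁ x)
      rw [hE, u₁.symm_apply_apply, dmap_apply, hu₁] at this
      simp [this]
  let ε₀ : N →+ N' :=
    { toFun := fun n => q (E (surjInv T.surj_q n))
      map_zero' := by rw [← hk, surjInv_eq T.surj_q]
      map_add' := fun m n => by
        rw [← map_add, ← map_add, ← sub_eq_zero, ← map_sub, ← map_sub, ← hk]
        simp [surjInv_eq T.surj_q] }
  have hε : ∀ f, ε₀ (T.q f) = q (E f) := fun f => by
    change q (E (surjInv T.surj_q (T.q f))) = _
    rw [← sub_eq_zero, ← map_sub, ← map_sub, ← hk]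
    simp [surjInv_eq T.surj_q]
  refine ⟨AddEquiv.ofBijective ε₀ ⟨?_, ?_⟩, ?_⟩
  · rw [injective_iff_map_eq_zero]
    intro n hn
    obtain ⟨f, rfl⟩ := T.surj_q n
    rwa [hε, ← hk] at hn
  · intro n
    obtain ⟨g, rfl⟩ := hq n
    obtain ⟨f, rfl⟩ := E.surjective g
    exact ⟨T.q f, hε f⟩
  · intro b n
    obtain ⟨f, rfl⟩ := T.surj_q n
    change ε₀ _ = σ b • ε₀ _
    have hEb : E (b • f) = σ b • E f := by ext x; simp [hE, hθ]
    rw [← map_smul, hε, hε, hEb, map_smul]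

lemma TrPres.nonempty_equiv [IsNoetherianRing A] {M' N' : Type u} [AddCommGroup M'] [Module A M']
    [AddCommGroup N'] [Module B N'] (T : TrPres A B W M N) (T' : TrPres A B W M' N')
    (e : M ≃ₗ[A] M') : Nonempty (N ≃ₗ[B] N') := by
  obtain ⟨ε, hε⟩ := T.exists_addEquiv T'.surj_p T'.exact_p T'.surj_q T'.exact_q T'.min_p T'.min_d
    e id (LinearEquiv.refl A W) fun _ _ => rfl
  exact ⟨{ ε with map_smul' := hε }⟩

lemma TrPres.finite (T : TrPres A B W M N) : Module.Finite A M :=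
  Module.Finite.of_surjective T.p T.surj_p

/-- The members of a transpose pair have no projective summands. -/
lemma TrPres.noProjSummand [SMulCommClass B A W] (T : TrPres A B W M N)
    (hW : IsRegularBimodule A B W) : NoProjSummand A M := by
  intro N₁ N₂ hc hN
  let π := Submodule.projectionOnto N₁ N₂ hc
  have hπ : Surjective (π ∘ₗ T.p) := by
    intro y
    obtain ⟨x, hx⟩ := T.surj_p y
    exact ⟨x, by simp [hx, π]⟩
  obtain ⟨s, hs⟩ := Module.projective_lifting_property (π ∘ₗ T.p) LinearMap.id hπ
  have hs' : ∀ y, π (T.p (s y)) = y := LinearMap.congr_fun hs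
  let c : T.P₀ →ₗ[A] T.P₀ := s ∘ₗ π ∘ₗ T.p
  have hcd : ∀ x, c (T.d x) = 0 := fun x => by
    simp [c, (T.exact_p _).2 ⟨x, rfl⟩]
  have hle : LinearMap.range (dmap A B W c) ≤ LinearMap.ker (dmap A B W T.d) := by
    rintro _ ⟨f, rfl⟩
    rw [LinearMap.mem_ker]
    ext x
    simp [hcd]
  have htop : LinearMap.range (LinearMap.id - dmap A B W c) = ⊤ := by
    refine T.min_dual _ (eq_top_iff.2 fun f _ => Submodule.mem_sup.2
      ⟨_, hle ⟨f, rfl⟩, _, ⟨f, rfl⟩, ?_⟩)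
    simp
  have hc0 : c = 0 := by
    ext x
    have hinj := (hW.dev_bijective T.P₀).1
    apply hinj
    ext f
    obtain ⟨g, rfl⟩ := LinearMap.range_eq_top.1 htop f
    simp [c, hs']
  rw [eq_bot_iff]
  intro y hy
  have h1 := congrArg (fun z => (π (T.p z) : M)) (LinearMap.congr_fun hc0 (s ⟨y, hy⟩))
  simpa [c, hs'] using h1

/-- A minimal presentation of a module without projective summands exhibits the transpose. -/
lemma exists_trPres_of_min [IsNoetherianRing A] [IsArtinianRing A] [SMulCommClass B A W]
    (hW : IsRegularBimodule A B W)
    {P₁ P₀ : Type u} [AddCommGroup P₁] [Module A P₁] [AddCommGroup P₀] [Module A P₀]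
    [Module.Finite A P₁] [Module.Finite A P₀] [Module.Projective A P₁] [Module.Projective A P₀]
    {d : P₁ →ₗ[A] P₀} {p : P₀ →ₗ[A] M} {q : (P₁ →ₗ[A] W) →ₗ[B] N} (hp : Surjective p)
    (hdp : Exact d p) (hq : Surjective q) (hdq : Exact (dmap A B W d) q)
    (hmp : IsSuperfluous A (LinearMap.ker p)) (hmd : IsSuperfluous A (LinearMap.ker d))
    [IsNoetherianRing B] (hM : NoProjSummand A M) : Nonempty (TrPres A B W M N) := by
  refine ⟨{ P₁ := P₁, P₀ := P₀, d := d, p := p, q := q, surj_p := hp, exact_p := hdp,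
            surj_q := hq, exact_q := hdq, min_p := hmp, min_d := hmd, min_dual := ?_ }⟩
  have := Module.Finite.of_surjective p hp
  obtain ⟨f₀, p₀⟩ := hW.dual_finite_projective P₀
  obtain ⟨n, α, hα⟩ := Module.Finite.exists_fin' B (LinearMap.ker (dmap A B W d))
  let F := Fin n → B
  let a : F →ₗ[B] (P₀ →ₗ[A] W) := (LinearMap.ker (dmap A B W d)).subtype ∘ₗ α
  have ha : LinearMap.range a = LinearMap.ker (dmap A B W d) := by
    rw [LinearMap.range_comp_of_range_eq_top _ (LinearMap.range_eq_top.2 hα),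
      Submodule.range_subtype]
  rw [← ha]
  refine isSuperfluous_range_of_surjective a fun k => ?_
  obtain ⟨fF, pF⟩ := hW.symm.dual_finite_projective F
  let e₀ := LinearEquiv.ofBijective _ (hW.dev_bijective P₀)
  obtain ⟨g, hg⟩ := hW.exists_dmap_eq (a ∘ₗ k)
  have had : ∀ v x, a v (d x) = 0 := fun v x =>
    LinearMap.congr_fun (LinearMap.mem_ker.1 (ha.le ⟨v, rfl⟩)) x
  -- the dual of `a` factors through `M`
  let a' : P₀ →ₗ[A] (F →ₗ[B] W) := dmap B A W a ∘ₗ dev A B W P₀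
  have ha' : LinearMap.ker p ≤ LinearMap.ker a' := by
    intro y hy
    obtain ⟨x, rfl⟩ := (hdp y).1 hy
    rw [LinearMap.mem_ker]
    ext v
    simp [a', had]
  let am : M →ₗ[A] (F →ₗ[B] W) :=
    (LinearMap.ker p).liftQ a' ha' ∘ₗ (p.quotKerEquivOfSurjective hp).symm.toLinearMap
  have ham : ∀ y, am (p y) = a' y := fun y => by
    have : (p.quotKerEquivOfSurjective hp).symm (p y) = Submodule.Quotient.mk y := by
      rw [LinearEquiv.symm_apply_eq]; rfl
    simp [am, this]
  let k' : (F →ₗ[B] W) →ₗ[A] P₀ := e₀.symm.toLinearMap ∘ₗ dmap B A W k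
  have hg' : g = k' ∘ₗ am ∘ₗ p := by
    ext y
    refine e₀.injective ?_
    ext f
    have h1 : e₀ (k' (am (p y))) = dmap B A W k (am (p y)) := e₀.apply_symm_apply _
    refine Eq.trans ?_ (LinearMap.congr_fun h1 f).symm
    rw [ham]
    exact LinearMap.congr_fun (LinearMap.congr_fun hg f) y
  have hinj := hM.injective_one_sub am (p ∘ₗ k')
  have hb : Bijective (LinearMap.id - (p ∘ₗ k') ∘ₗ am : M →ₗ[A] M) := by
    have : IsArtinian A M := inferInstance
    exact ⟨hinj, IsArtinian.surjective_of_injective_endomorphism _ hinj⟩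
  have hb2 : Bijective (LinearMap.id - (k' ∘ₗ am) ∘ₗ p : P₀ →ₗ[A] P₀) :=
    bijective_one_sub_swap (f := p) (g := k' ∘ₗ am) hb
  have hb3 := (bijective_dmap (B := B) (W := W) hb2).2
  intro f
  obtain ⟨f', hf'⟩ := hb3 f
  refine ⟨f', ?_⟩
  rw [← hf', LinearMap.sub_apply, ← hg, hg']
  ext y
  simp

end Transpose

section Counting

lemma noProjSummand_iff {A : Type u} [Ring A] {M : Type u} [AddCommGroup M] [Module A M] :
    NoProjSummand A M ↔ ∀ (P : Type u) [AddCommGroup P] [Module A P], Module.Projective A P →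
      ∀ (s : P →ₗ[A] M) (t : M →ₗ[A] P), t ∘ₗ s = LinearMap.id → Subsingleton P := by
  constructor
  · intro h P _ _ hP s t hts
    have hs : ∀ x, t (s x) = x := LinearMap.congr_fun hts
    have hinj : Injective s := LeftInverse.injective hs
    have hc : IsCompl (LinearMap.range s) (LinearMap.ker (s.rangeRestrict ∘ₗ t)) :=
      LinearMap.isCompl_of_proj (by rintro ⟨_, x, rfl⟩; ext; simp [hs])
    have := h (LinearMap.range s) _
      hc
      (Module.Projective.of_equiv (LinearEquiv.ofInjective s hinj))
    rw [LinearMap.range_eq_bot] at this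
    exact ⟨fun x y => hinj (by rw [this]; rfl)⟩
  · intro h N₁ N₂ hc hN
    have := h N₁ hN N₁.subtype (Submodule.projectionOnto _ _ hc) (by ext1; simp)
    exact Submodule.subsingleton_iff_eq_bot.1 this

lemma NoProjSummand.of_retract {A : Type u} [Ring A] {M N : Type u} [AddCommGroup M] [Module A M]
    [AddCommGroup N] [Module A N] (h : NoProjSummand A M) (i : N →ₗ[A] M) (r : M →ₗ[A] N)
    (hri : r ∘ₗ i = LinearMap.id) : NoProjSummand A N := by
  rw [noProjSummand_iff] at h ⊢
  intro P _ _ hP s t hts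
  refine h P hP (i ∘ₗ s) (t ∘ₗ r) ?_
  ext x
  have hri' : ∀ y, r (i y) = y := LinearMap.congr_fun hri
  have hts' : ∀ y, t (s y) = y := LinearMap.congr_fun hts
  simp [hri', hts']

/-- The summands of an internal direct sum decomposition. -/
noncomputable def equivPiOfIsInternal {A : Type u} [Ring A] {M : Type u} [AddCommGroup M]
    [Module A M] {ι : Type} [Fintype ι] [DecidableEq ι] {S : ι → Submodule A M}
    (h : DirectSum.IsInternal S) : M ≃ₗ[A] ∀ i, S i :=
  (LinearEquiv.ofBijective (DirectSum.coeLinearMap S) h).symm ≪≫ₗ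
    DirectSum.linearEquivFunOnFintype A ι _

lemma exists_isInternal_of_equiv_pi {A : Type u} [Ring A] {M : Type u} [AddCommGroup M]
    [Module A M] {ι : Type} [Fintype ι] [DecidableEq ι] {N : ι → Type u}
    [∀ i, AddCommGroup (N i)] [∀ i, Module A (N i)] (e : M ≃ₗ[A] ∀ i, N i) :
    ∃ S : ι → Submodule A M, DirectSum.IsInternal S ∧ ∀ i, Nonempty (S i ≃ₗ[A] N i) := by
  have hinj : ∀ i, Injective (e.symm.toLinearMap ∘ₗ LinearMap.single A N i) := fun i =>
    e.symm.injective.comp (Pi.single_injective i)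
  refine ⟨fun i => LinearMap.range (e.symm.toLinearMap ∘ₗ LinearMap.single A N i), ?_,
    fun i => ⟨(LinearEquiv.ofInjective _ (hinj i)).symm⟩⟩
  rw [DirectSum.isInternal_submodule_iff_iSupIndep_and_iSup_eq_top]
  constructor
  · rw [iSupIndep_def]
    intro i
    rw [Submodule.disjoint_def]
    rintro _ ⟨x, rfl⟩ hx
    have hle : (⨆ (j) (_ : j ≠ i), LinearMap.range (e.symm.toLinearMap ∘ₗ LinearMap.single A N j))
        ≤ LinearMap.ker (LinearMap.proj i ∘ₗ e.toLinearMap) := by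
      refine iSup₂_le fun j hj => ?_
      rintro _ ⟨y, rfl⟩
      simp [Pi.single_eq_of_ne hj.symm]
    have := LinearMap.mem_ker.1 (hle hx)
    have hx0 : x = 0 := by simpa using this
    rw [hx0, map_zero]
  · rw [eq_top_iff]
    intro x _
    have hx : x = ∑ i, e.symm (Pi.single i (e x i)) := by
      rw [← map_sum, ← LinearMap.sum_single_apply _ (e x) |>.symm]
      simp
    rw [hx]
    exact Submodule.sum_mem _ fun i _ => Submodule.mem_iSup_of_mem i ⟨e x i, rfl⟩

lemma IsIndec.of_equiv {A : Type u} [Ring A] {M N : Type u} [AddCommGroup M] [Module A M]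
    [AddCommGroup N] [Module A N] (h : IsIndec A M) (e : M ≃ₗ[A] N) : IsIndec A N := by
  refine ⟨e.symm.toEquiv.nontrivial_congr.2 h.1, fun N₁ N₂ hc => ?_⟩
  have hc' : IsCompl (Submodule.orderIsoMapComap e.symm N₁)
      (Submodule.orderIsoMapComap e.symm N₂) := (OrderIso.isCompl_iff _).1 hc
  refine (h.2 _ _ hc').imp (fun h => ?_) fun h => ?_ <;>
  exact (map_eq_bot_iff (Submodule.orderIsoMapComap e.symm)).1 h

/-- A correspondence between isomorphism classes of certain `A`-modules and certain `B`-modules,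
compatible with finite direct sums and direct summands on either side. -/
structure IsSumCorrespondence (A B : Type u) [Ring A] [Ring B]
    (T : ∀ (M N : Type u) [AddCommGroup M] [Module A M] [AddCommGroup N] [Module B N], Prop) :
    Prop where
  iso_right : ∀ {M N M' N' : Type u} [AddCommGroup M] [Module A M] [AddCommGroup N] [Module B N]
    [AddCommGroup M'] [Module A M'] [AddCommGroup N'] [Module B N'], T M N → T M' N' →
    Nonempty (M ≃ₗ[A] M') → Nonempty (N ≃ₗ[B] N')
  iso_left : ∀ {M N M' N' : Type u} [AddCommGroup M] [Module A M] [AddCommGroup N] [Module B N]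
    [AddCommGroup M'] [Module A M'] [AddCommGroup N'] [Module B N'], T M N → T M' N' →
    Nonempty (N ≃ₗ[B] N') → Nonempty (M ≃ₗ[A] M')
  pi : ∀ {ι : Type} [Fintype ι] [DecidableEq ι] {M N : ι → Type u} [∀ i, AddCommGroup (M i)]
    [∀ i, Module A (M i)] [∀ i, AddCommGroup (N i)] [∀ i, Module B (N i)],
    (∀ i, T (M i) (N i)) → T (∀ i, M i) (∀ i, N i)
  summand_left : ∀ {M N M' : Type u} [AddCommGroup M] [Module A M] [AddCommGroup N]
    [Module B N] [AddCommGroup M'] [Module A M'] (i : M' →ₗ[A] M) (r : M →ₗ[A] M'),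
    r ∘ₗ i = LinearMap.id → T M N → ∃ (N' : Type u) (_ : AddCommGroup N') (_ : Module B N'), T M' N'
  summand_right : ∀ {M N N' : Type u} [AddCommGroup M] [Module A M] [AddCommGroup N]
    [Module B N] [AddCommGroup N'] [Module B N'] (i : N' →ₗ[B] N) (r : N →ₗ[B] N'),
    r ∘ₗ i = LinearMap.id → T M N → ∃ (M' : Type u) (_ : AddCommGroup M') (_ : Module A M'), T M' N'

namespace IsSumCorrespondence

variable {A B : Type u} [Ring A] [Ring B]
  {T : ∀ (M N : Type u) [AddCommGroup M] [Module A M] [AddCommGroup N] [Module B N], Prop}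

lemma symm (h : IsSumCorrespondence A B T) :
    IsSumCorrespondence B A (fun N M _ _ _ _ => T M N) where
  iso_right := h.iso_left
  iso_left := h.iso_right
  pi := h.pi
  summand_left := h.summand_right
  summand_right := h.summand_left

variable {M N : Type u} [AddCommGroup M] [Module A M] [AddCommGroup N] [Module B N]

lemma subsingleton (h : IsSumCorrespondence A B T) (hT : T M N) [Subsingleton M] :
    Subsingleton N := by
  have h0 : T (∀ _ : Empty, M) (∀ _ : Empty, N) := h.pi fun i => i.elim
  obtain ⟨e⟩ := h.iso_right hT h0 ⟨0⟩
  exact e.injective.subsingleton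

lemma isIndec (h : IsSumCorrespondence A B T) (hT : T M N) (hM : IsIndec A M) : IsIndec B N := by
  have := hM.1
  refine ⟨not_subsingleton_iff_nontrivial.1 fun _ =>
    not_subsingleton M (h.symm.subsingleton hT), fun N₁ N₂ hc => ?_⟩
  let S : Bool → Submodule B N := fun b => cond b N₁ N₂
  have hS : DirectSum.IsInternal S :=
    (DirectSum.isInternal_submodule_iff_isCompl S (i := true) (j := false) (by simp)
      (by ext b; cases b <;> simp)).2 hc
  let e := equivPiOfIsInternal hS
  choose M' _ _ hM' using fun b => h.summand_right (e.symm.toLinearMap ∘ₗ LinearMap.single B _ b)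
    (LinearMap.proj b ∘ₗ e.toLinearMap) (by ext1; simp) hT
  obtain ⟨f⟩ := h.iso_left hT (h.pi hM') ⟨e⟩
  obtain ⟨S', hS', hi⟩ := exists_isInternal_of_equiv_pi f
  have hc' := (DirectSum.isInternal_submodule_iff_isCompl S' (i := true) (j := false) (by simp)
      (by ext b; cases b <;> simp)).1 hS'
  have key : ∀ b, S' b = ⊥ → S b = ⊥ := fun b hb => by
    obtain ⟨g⟩ := hi b
    have h1 : Subsingleton (S' b) := Submodule.subsingleton_iff_eq_bot.2 hb
    have h2 : Subsingleton (M' b) := g.symm.injective.subsingleton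
    exact Submodule.subsingleton_iff_eq_bot.1 (h.subsingleton (hM' b))
  exact (hM.2 _ _ hc').imp (key true) (key false)

lemma numIndec (h : IsSumCorrespondence A B T) (hT : T M N) {k : ℕ} (hM : NumIndec A M k) :
    NumIndec B N k := by
  obtain ⟨n, S, hS, hind, c, hc, hcS⟩ := hM
  let e := equivPiOfIsInternal hS
  choose N' _ _ hN' using fun b => h.summand_left (e.symm.toLinearMap ∘ₗ LinearMap.single A _ b)
    (LinearMap.proj b ∘ₗ e.toLinearMap) (by ext1; simp) hT
  obtain ⟨f⟩ := h.iso_right hT (h.pi hN') ⟨e⟩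
  obtain ⟨S', hS', hi⟩ := exists_isInternal_of_equiv_pi f
  refine ⟨n, S', hS', fun i => ?_, c, hc, fun i j => ?_⟩
  · obtain ⟨g⟩ := hi i
    exact (h.isIndec (hN' i) (hind i)).of_equiv g.symm
  · obtain ⟨gi⟩ := hi i
    obtain ⟨gj⟩ := hi j
    rw [hcS]
    constructor
    · intro hij
      obtain ⟨g⟩ := h.iso_right (hN' i) (hN' j) hij
      exact ⟨gi ≪≫ₗ g ≪≫ₗ gj.symm⟩
    · rintro ⟨g⟩
      exact h.iso_left (hN' i) (hN' j) ⟨gi.symm ≪≫ₗ g ≪≫ₗ gj⟩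

lemma numIndec_iff (h : IsSumCorrespondence A B T) (hT : T M N) (k : ℕ) :
    NumIndec A M k ↔ NumIndec B N k :=
  ⟨h.numIndec hT, h.symm.numIndec hT⟩

end IsSumCorrespondence

variable {A B W : Type u} [Ring A] [Ring B] [AddCommGroup W] [Module A W] [Module B W]
  [SMulCommClass A B W]

/-- Maps out of a finite product, as a product of maps. -/
def dualPiEquiv (B W : Type u) [Ring B] [AddCommGroup W] [Module A W] [Module B W]
    [SMulCommClass A B W] {ι : Type} [Fintype ι] [DecidableEq ι] (M : ι → Type u)
    [∀ i, AddCommGroup (M i)] [∀ i, Module A (M i)] :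
    ((∀ i, M i) →ₗ[A] W) ≃ₗ[B] (∀ i, M i →ₗ[A] W) :=
  (LinearMap.lsum A M B).symm

lemma projective_pi {ι : Type} [Fintype ι] [DecidableEq ι] (M : ι → Type u)
    [∀ i, AddCommGroup (M i)] [∀ i, Module A (M i)] [∀ i, Module.Projective A (M i)] :
    Module.Projective A (∀ i, M i) :=
  Module.Projective.of_equiv (DirectSum.linearEquivFunOnFintype A ι M)

/-- A finite product of presentations exhibiting transposes. -/
lemma TrPres.nonempty_pi {ι : Type} [Fintype ι] [DecidableEq ι] {M N : ι → Type u}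
    [∀ i, AddCommGroup (M i)] [∀ i, Module A (M i)] [∀ i, AddCommGroup (N i)]
    [∀ i, Module B (N i)] (T : ∀ i, TrPres A B W (M i) (N i)) :
    Nonempty (TrPres A B W (∀ i, M i) (∀ i, N i)) := by
  let d : (∀ i, (T i).P₁) →ₗ[A] ∀ i, (T i).P₀ :=
    LinearMap.pi fun i => (T i).d ∘ₗ LinearMap.proj (R := A) (φ := fun i => (T i).P₁) i
  let E₁ := dualPiEquiv (A := A) B W fun i => (T i).P₁
  let E₀ := dualPiEquiv (A := A) B W fun i => (T i).P₀
  have hE : ∀ f i, E₁ (dmap A B W d f) i = dmap A B W (T i).d (E₀ f i) := fun f i => by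
    ext x
    change f (d (Pi.single i x)) = f (Pi.single i ((T i).d x))
    congr 1
    ext j
    by_cases h : j = i
    · subst h; simp [d]
    · simp [d, Pi.single_eq_of_ne h]
  have hker : ∀ f, f ∈ LinearMap.ker (dmap A B W d) ↔
      ∀ i, E₀ f i ∈ LinearMap.ker (dmap A B W (T i).d) := fun f => by
    rw [LinearMap.mem_ker, ← E₁.map_eq_zero_iff, funext_iff]
    exact forall_congr' fun i => by rw [hE]; rfl
  refine ⟨{
    P₁ := ∀ i, (T i).P₁
    P₀ := ∀ i, (T i).P₀
    d := d
    p := LinearMap.pi fun i => (T i).p ∘ₗ LinearMap.proj (R := A) (φ := fun i => (T i).P₀) i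
    q := (LinearMap.pi fun i => (T i).q ∘ₗ
      LinearMap.proj (R := B) (φ := fun i => (T i).P₁ →ₗ[A] W) i) ∘ₗ E₁.toLinearMap
    proj₁ := projective_pi _
    proj₀ := projective_pi _
    surj_p := fun y => ?_
    exact_p := fun y => ?_
    surj_q := fun y => ?_
    exact_q := fun y => ?_
    min_p := ?_
    min_d := ?_
    min_dual := ?_ }⟩
  · choose x hx using fun i => (T i).surj_p (y i)
    exact ⟨x, funext hx⟩
  · rw [funext_iff]
    refine (forall_congr' fun i => (T i).exact_p (y i)).trans ?_
    constructor
    · intro h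
      choose x hx using h
      exact ⟨x, funext hx⟩
    · rintro ⟨x, rfl⟩ i
      exact ⟨x i, rfl⟩
  · choose x hx using fun i => (T i).surj_q (y i)
    refine ⟨E₁.symm x, funext fun i => ?_⟩
    simpa using hx i
  · rw [funext_iff]
    refine (forall_congr' fun i => (T i).exact_q (E₁ y i)).trans ?_
    constructor
    · intro h
      choose x hx using h
      refine ⟨E₀.symm x, E₁.injective (funext fun i => ?_)⟩
      rw [hE, E₀.apply_symm_apply, hx]
    · rintro ⟨x, rfl⟩ i
      exact ⟨E₀ x i, (hE x i).symm⟩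
  · convert IsSuperfluous.pi fun i => (T i).min_p
    ext x
    simp [funext_iff, Submodule.mem_pi]
  · convert IsSuperfluous.pi fun i => (T i).min_d
    ext x
    simp [d, funext_iff, Submodule.mem_pi]
  · refine (IsSuperfluous.pi fun i => (T i).min_dual).of_equiv E₀.symm fun x => ?_
    rw [hker, E₀.apply_symm_apply]
    simp [Submodule.mem_pi]

lemma TrPres.exists_of_retract [IsNoetherianRing A] [IsArtinianRing A] [IsNoetherianRing B]
    [SMulCommClass B A W] (hW : IsRegularBimodule A B W) {M N M' : Type u} [AddCommGroup M]
    [Module A M] [AddCommGroup N] [Module B N] [AddCommGroup M'] [Module A M']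
    (i : M' →ₗ[A] M) (r : M →ₗ[A] M') (hri : r ∘ₗ i = LinearMap.id) (T : TrPres A B W M N) :
    ∃ (N' : Type u) (_ : AddCommGroup N') (_ : Module B N'), Nonempty (TrPres A B W M' N') := by
  have := T.finite
  have : Module.Finite A M' :=
    Module.Finite.of_surjective r fun x => ⟨i x, LinearMap.congr_fun hri x⟩
  obtain ⟨pr⟩ := exists_minPres (A := A) M'
  have := pr.fin₁
  have := pr.fin₀
  have := pr.proj₁
  have := pr.proj₀
  refine ⟨(pr.P₁ →ₗ[A] W) ⧸ LinearMap.range (dmap A B W pr.d), inferInstance, inferInstance, ?_⟩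
  refine exists_trPres_of_min hW (q := (LinearMap.range (dmap A B W pr.d)).mkQ) pr.surj pr.exact
    (Submodule.mkQ_surjective _) ?_ pr.min₀ pr.min₁ ((T.noProjSummand hW).of_retract i r hri)
  rw [LinearMap.exact_iff, Submodule.ker_mkQ]

lemma isSumCorrespondence_trPres [IsNoetherianRing A] [IsArtinianRing A] [IsNoetherianRing B]
    [IsArtinianRing B] [SMulCommClass B A W] (hW : IsRegularBimodule A B W) :
    IsSumCorrespondence A B (fun M N _ _ _ _ => Nonempty (TrPres A B W M N)) where
  iso_right := fun ⟨T⟩ ⟨T'⟩ ⟨e⟩ => T.nonempty_equiv T' e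
  iso_left := fun ⟨T⟩ ⟨T'⟩ ⟨e⟩ => by
    obtain ⟨S⟩ := T.nonempty_swap hW
    obtain ⟨S'⟩ := T'.nonempty_swap hW
    exact S.nonempty_equiv S' e
  pi := fun h => TrPres.nonempty_pi fun i => (h i).some
  summand_left := fun i r hri ⟨T⟩ => T.exists_of_retract hW i r hri
  summand_right := fun i r hri ⟨T⟩ => by
    obtain ⟨S⟩ := T.nonempty_swap hW
    obtain ⟨N', _, _, ⟨S'⟩⟩ := S.exists_of_retract hW.symm i r hri
    exact ⟨N', _, _, S'.nonempty_swap hW.symm⟩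

/-- `W`-duality between finitely generated projective modules. -/
def IsProjDual (A B W : Type u) [Ring A] [Ring B] [AddCommGroup W] [Module A W] [Module B W]
    [SMulCommClass A B W] (P Q : Type u) [AddCommGroup P] [Module A P] [AddCommGroup Q]
    [Module B Q] : Prop :=
  Module.Finite A P ∧ Module.Projective A P ∧ Nonempty (Q ≃ₗ[B] (P →ₗ[A] W))

lemma IsProjDual.swap [SMulCommClass B A W] (hW : IsRegularBimodule A B W) {P Q : Type u}
    [AddCommGroup P] [Module A P] [AddCommGroup Q] [Module B Q] (h : IsProjDual A B W P Q) :
    IsProjDual B A W Q P := by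
  obtain ⟨_, _, ⟨e⟩⟩ := h
  obtain ⟨_, _⟩ := hW.dual_finite_projective P
  exact ⟨Module.Finite.equiv e.symm, Module.Projective.of_equiv e.symm,
    ⟨LinearEquiv.ofBijective _ (hW.dev_bijective P) ≪≫ₗ dcongr A W e⟩⟩

lemma IsProjDual.exists_of_retract {P Q P' : Type u} [AddCommGroup P] [Module A P]
    [AddCommGroup Q] [Module B Q] [AddCommGroup P'] [Module A P'] (h : IsProjDual A B W P Q)
    (i : P' →ₗ[A] P) (r : P →ₗ[A] P') (hri : r ∘ₗ i = LinearMap.id) :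
    ∃ (Q' : Type u) (_ : AddCommGroup Q') (_ : Module B Q'), IsProjDual A B W P' Q' := by
  obtain ⟨_, _, -⟩ := h
  exact ⟨P' →ₗ[A] W, inferInstance, inferInstance,
    Module.Finite.of_surjective r fun x => ⟨i x, LinearMap.congr_fun hri x⟩,
    Module.Projective.of_split i r hri, ⟨LinearEquiv.refl _ _⟩⟩

lemma isSumCorrespondence_isProjDual [SMulCommClass B A W] (hW : IsRegularBimodule A B W) :
    IsSumCorrespondence A B (fun P Q _ _ _ _ => IsProjDual A B W P Q) where
  iso_right := fun ⟨_, _, ⟨e⟩⟩ ⟨_, _, ⟨e'⟩⟩ ⟨g⟩ => ⟨e ≪≫ₗ dcongr B W g.symm ≪≫ₗ e'.symm⟩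
  iso_left := fun h h' ⟨g⟩ => by
    obtain ⟨-, -, ⟨e⟩⟩ := h.swap hW
    obtain ⟨-, -, ⟨e'⟩⟩ := h'.swap hW
    exact ⟨e ≪≫ₗ dcongr A W g.symm ≪≫ₗ e'.symm⟩
  pi := fun h => by
    have := fun i => (h i).1
    have := fun i => (h i).2.1
    exact ⟨inferInstance, projective_pi _,
      ⟨LinearEquiv.piCongrRight (fun i => (h i).2.2.some) ≪≫ₗ (dualPiEquiv B W _).symm⟩⟩
  summand_left := fun i r hri h => h.exists_of_retract i r hri
  summand_right := fun i r hri h => by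
    obtain ⟨P', _, _, h'⟩ := (h.swap hW).exists_of_retract i r hri
    exact ⟨P', _, _, h'.swap hW.symm⟩

/-- The number of indecomposable summands of the regular module is left-right symmetric. -/
lemma numIndec_self_op_iff (R : Type u) [Ring R] (k : ℕ) :
    NumIndec R R k ↔ NumIndec Rᵐᵒᵖ Rᵐᵒᵖ k := by
  refine (isSumCorrespondence_isProjDual (isRegularBimodule_op R)).numIndec_iff
    ⟨inferInstance, inferInstance, ⟨?_⟩⟩ k
  refine LinearEquiv.ofBijective (LinearMap.toSpanSingleton Rᵐᵒᵖ (R →ₗ[R] R) LinearMap.id) ⟨?_, ?_⟩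
  · rw [injective_iff_map_eq_zero]
    intro x hx
    simpa using LinearMap.congr_fun hx 1
  · exact fun f => ⟨op (f 1), by ext; simp⟩

end Counting

section GorensteinProjective

section Factor

variable {A : Type u} [Ring A] {X Y P Z : Type u} [AddCommGroup X] [Module A X] [AddCommGroup Y]
  [Module A Y] [AddCommGroup P] [Module A P] [AddCommGroup Z] [Module A Z]

lemma exists_comp_eq_of_surjective {p : P →ₗ[A] Y} (hp : Surjective p) (g : P →ₗ[A] Z)
    (h : ∀ x, p x = 0 → g x = 0) : ∃ g' : Y →ₗ[A] Z, ∀ x, g' (p x) = g x :=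
  ⟨(LinearMap.ker p).liftQ g h ∘ₗ (p.quotKerEquivOfSurjective hp).symm.toLinearMap,
    fun x => by
      rw [LinearMap.comp_apply, LinearEquiv.coe_coe,
        LinearMap.quotKerEquivOfSurjective_symm_apply]
      rfl⟩

lemma exists_comp_eq_of_exact {i : X →ₗ[A] P} {p : P →ₗ[A] Y} (hi : Injective i)
    (he : Exact i p) (g : Z →ₗ[A] P) (h : ∀ z, p (g z) = 0) :
    ∃ g' : Z →ₗ[A] X, ∀ z, i (g' z) = g z :=
  ⟨(LinearEquiv.ofInjective i hi).symm.toLinearMap ∘ₗ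
    g.codRestrict (LinearMap.range i) fun z => (he _).1 (h z), fun z =>
    congrArg Subtype.val ((LinearEquiv.ofInjective i hi).apply_symm_apply ⟨g z, _⟩)⟩

lemma nonempty_equiv_of_ker_eq {f : P →ₗ[A] X} {g : P →ₗ[A] Y} (hf : Surjective f)
    (hg : Surjective g) (h : ∀ x, f x = 0 ↔ g x = 0) : Nonempty (X ≃ₗ[A] Y) :=
  ⟨(f.quotKerEquivOfSurjective hf).symm ≪≫ₗ
    Submodule.quotEquivOfEq _ _ (SetLike.ext h) ≪≫ₗ g.quotKerEquivOfSurjective hg⟩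

end Factor

/-- A short exact sequence `0 → X → P → Y → 0` such that all maps `X → W` extend to `P`. -/
structure IsLink {A : Type u} [Ring A] (W : Type u) [AddCommGroup W] [Module A W]
    {X P Y : Type u} [AddCommGroup X] [Module A X] [AddCommGroup P] [Module A P] [AddCommGroup Y]
    [Module A Y] (i : X →ₗ[A] P) (p : P →ₗ[A] Y) : Prop where
  inj : Injective i
  surj : Surjective p
  exact : Exact i p
  extend : ∀ g : X →ₗ[A] W, ∃ h : P →ₗ[A] W, ∀ x, h (i x) = g x

/-- There is a short exact sequence `0 → X → P → Y → 0` with `P` finitely generated projective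
such that all maps `X → W` extend to `P`. -/
def Link (A : Type u) [Ring A] (W : Type u) [AddCommGroup W] [Module A W] (X Y : Type u)
    [AddCommGroup X] [Module A X] [AddCommGroup Y] [Module A Y] : Prop :=
  ∃ (P : Type u) (_ : AddCommGroup P) (_ : Module A P), Module.Finite A P ∧
    Module.Projective A P ∧ ∃ (i : X →ₗ[A] P) (p : P →ₗ[A] Y), IsLink W i p

/-- `M` occurs in a doubly infinite chain of links. -/
def HasChain (A : Type u) [Ring A] (W : Type u) [AddCommGroup W] [Module A W] (M : Type u)
    [AddCommGroup M] [Module A M] : Prop :=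
  ∃ X : ℤ → ModuleCat.{u} A, Nonempty (M ≃ₗ[A] X 0) ∧ ∀ n, Link A W (X n) (X (n + 1))

section OneRing

variable {A : Type u} [Ring A] {W : Type u} [AddCommGroup W] [Module A W]
  {X Y : Type u} [AddCommGroup X] [Module A X] [AddCommGroup Y] [Module A Y]

lemma Link.finite (h : Link A W X Y) : Module.Finite A Y := by
  obtain ⟨P, _, _, _, _, i, p, h⟩ := h
  exact Module.Finite.of_surjective p h.surj

lemma Link.of_equiv_left (h : Link A W X Y) {X' : Type u} [AddCommGroup X'] [Module A X']
    (e : X' ≃ₗ[A] X) : Link A W X' Y := by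
  obtain ⟨P, _, _, _, _, i, p, h⟩ := h
  refine ⟨P, _, _, ‹_›, ‹_›, i ∘ₗ e.toLinearMap, p, h.inj.comp e.injective, h.surj, fun y => ?_,
    fun g => ?_⟩
  · rw [h.exact y, LinearMap.coe_comp, LinearEquiv.coe_coe, e.surjective.range_comp]
  · obtain ⟨k, hk⟩ := h.extend (g ∘ₗ e.symm.toLinearMap)
    exact ⟨k, fun x => by simp [hk]⟩

lemma Link.of_equiv_right (h : Link A W X Y) {Y' : Type u} [AddCommGroup Y'] [Module A Y']
    (e : Y ≃ₗ[A] Y') : Link A W X Y' := by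
  obtain ⟨P, _, _, _, _, i, p, h⟩ := h
  refine ⟨P, _, _, ‹_›, ‹_›, i, e.toLinearMap ∘ₗ p, h.inj, e.surjective.comp h.surj, fun y => ?_,
    h.extend⟩
  rw [← h.exact y]
  exact e.map_eq_zero_iff

lemma Link.congr (h : Link A W X Y) {W' : Type u} [AddCommGroup W'] [Module A W']
    (e : W ≃ₗ[A] W') : Link A W' X Y := by
  obtain ⟨P, _, _, _, _, i, p, h⟩ := h
  refine ⟨P, _, _, ‹_›, ‹_›, i, p, h.inj, h.surj, h.exact, fun g => ?_⟩
  obtain ⟨k, hk⟩ := h.extend (e.symm.toLinearMap ∘ₗ g)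
  exact ⟨e.toLinearMap ∘ₗ k, fun x => by simp [hk]⟩

lemma HasChain.congr {M : Type u} [AddCommGroup M] [Module A M] (h : HasChain A W M)
    {W' : Type u} [AddCommGroup W'] [Module A W'] (e : W ≃ₗ[A] W') : HasChain A W' M := by
  obtain ⟨X, hM, hX⟩ := h
  exact ⟨X, hM, fun n => (hX n).congr e⟩

lemma HasChain.of_equiv {M M' : Type u} [AddCommGroup M] [Module A M] [AddCommGroup M']
    [Module A M'] (h : HasChain A W M) (e : M' ≃ₗ[A] M) : HasChain A W M' := by
  obtain ⟨X, ⟨f⟩, hX⟩ := h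
  exact ⟨X, ⟨e ≪≫ₗ f⟩, hX⟩

lemma isGP_iff_hasChain (M : Type u) [AddCommGroup M] [Module A M] :
    IsGP A M ↔ HasChain A A M := by
  constructor
  · rintro ⟨P, _, _, d, hf, hp, hd, hdual, ⟨e⟩⟩
    have key : ∀ k n, n + 1 = k → Nonempty (LinearMap.range (d n) ≃ₗ[A] LinearMap.ker (d k)) := by
      rintro _ n rfl
      exact ⟨LinearEquiv.ofEq _ _ (LinearMap.exact_iff.1 (hd n)).symm⟩
    obtain ⟨f⟩ := key 0 (-1) rfl
    refine ⟨fun n => ModuleCat.of A (LinearMap.ker (d n)), ⟨e ≪≫ₗ f⟩, fun n => ?_⟩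
    obtain ⟨m, rfl⟩ : ∃ m, n = m + 1 + 1 := ⟨n - 2, by ring⟩
    refine ⟨P (m + 1 + 1), _, _, hf _, hp _, (LinearMap.ker (d (m + 1 + 1))).subtype,
      (d (m + 1 + 1)).codRestrict (LinearMap.ker (d (m + 1 + 1 + 1)))
        fun x => (hd _ _).2 ⟨x, rfl⟩, Subtype.val_injective, ?_, ?_, fun g => ?_⟩
    · rintro ⟨y, hy⟩
      obtain ⟨x, hx⟩ := (hd _ _).1 hy
      exact ⟨x, Subtype.ext hx⟩
    · intro x
      rw [Subtype.ext_iff]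
      exact ⟨fun h => ⟨⟨x, h⟩, rfl⟩, by rintro ⟨y, rfl⟩; exact y.2⟩
    · let g' : P (m + 1) →ₗ[A] A := g ∘ₗ
        (d (m + 1)).codRestrict (LinearMap.ker (d (m + 1 + 1))) fun x => (hd _ _).2 ⟨x, rfl⟩
      obtain ⟨h, hh⟩ := (hdual m g').1 (by
        ext x
        have hx : (d (m + 1)).codRestrict (LinearMap.ker (d (m + 1 + 1)))
          (fun x => (hd _ _).2 ⟨x, rfl⟩) (d m x) = 0 := Subtype.ext ((hd _ _).2 ⟨x, rfl⟩)
        exact (congrArg g hx).trans (map_zero g))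
      refine ⟨h, ?_⟩
      rintro ⟨y, hy⟩
      obtain ⟨x, rfl⟩ := (hd _ _).1 hy
      exact LinearMap.congr_fun hh x
  · rintro ⟨X, ⟨e⟩, hX⟩
    choose P _ _ hf hp i p h using hX
    refine ⟨P, inferInstance, inferInstance, fun n => i (n + 1) ∘ₗ p n, hf, hp, fun n y => ?_,
      fun n g => ?_, ?_⟩
    · rw [LinearMap.comp_apply, (map_eq_zero_iff _ (h (n + 1 + 1)).inj), (h (n + 1)).exact,
        LinearMap.coe_comp, (h n).surj.range_comp]
    · constructor
      · intro hg
        have hg0 : ∀ x, g (i (n + 1) x) = 0 := fun x => by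
          obtain ⟨y, rfl⟩ := (h n).surj x
          exact LinearMap.congr_fun hg y
        obtain ⟨g', hg'⟩ := exists_comp_eq_of_surjective (h (n + 1)).surj g fun x hx => by
          obtain ⟨y, rfl⟩ := ((h (n + 1)).exact x).1 hx
          exact hg0 y
        obtain ⟨k, hk⟩ := (h (n + 1 + 1)).extend g'
        exact ⟨k, LinearMap.ext fun x => by
          change k (i _ (p _ x)) = g x
          rw [hk, hg']⟩
      · rintro ⟨k, rfl⟩
        ext x
        change k (i _ (p _ (i _ (p n x)))) = 0
        rw [((h (n + 1)).exact _).2 ⟨_, rfl⟩, map_zero, map_zero]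
    · have key : ∀ k n, n + 1 = k → Nonempty (X k ≃ₗ[A] LinearMap.range (i (n + 1) ∘ₗ p n)) := by
        rintro _ n rfl
        exact ⟨LinearEquiv.ofInjective _ (h (n + 1)).inj ≪≫ₗ LinearEquiv.ofEq _ _
          (LinearMap.range_comp_of_range_eq_top _ (LinearMap.range_eq_top.2 (h n).surj)).symm⟩
      obtain ⟨f⟩ := key 0 (-1) rfl
      exact ⟨e ≪≫ₗ f⟩

/-- A chain can be spliced from classes of modules closed under taking predecessors and
successors. -/
lemma hasChain_iff (M : Type u) [AddCommGroup M] [Module A M] : HasChain A W M ↔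
    (∃ C : ModuleCat.{u} A → Prop, C (ModuleCat.of A M) ∧
      ∀ Y, C Y → ∃ X, C X ∧ Link A W X Y) ∧
    ∃ C : ModuleCat.{u} A → Prop, C (ModuleCat.of A M) ∧
      ∀ X, C X → ∃ Y, C Y ∧ Link A W X Y := by
  constructor
  · rintro ⟨X, ⟨e⟩, hX⟩
    constructor
    · refine ⟨fun Y => ∃ n, Nonempty (Y ≃ₗ[A] X n), ⟨0, ⟨e⟩⟩, ?_⟩
      rintro Y ⟨n, ⟨f⟩⟩
      obtain ⟨n, rfl⟩ : ∃ m, n = m + 1 := ⟨n - 1, by ring⟩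
      exact ⟨X n, ⟨n, ⟨LinearEquiv.refl _ _⟩⟩, (hX n).of_equiv_right f.symm⟩
    · refine ⟨fun Y => ∃ n, Nonempty (Y ≃ₗ[A] X n), ⟨0, ⟨e⟩⟩, ?_⟩
      rintro Y ⟨n, ⟨f⟩⟩
      exact ⟨X (n + 1), ⟨n + 1, ⟨LinearEquiv.refl _ _⟩⟩, (hX n).of_equiv_left f⟩
  · rintro ⟨⟨C, hC, hC'⟩, C', hM, hM'⟩
    choose a ha hal using hC'
    choose b hb hbl using hM'
    let x : ℕ → {Y // C Y} := Nat.rec ⟨_, hC⟩ fun _ Y => ⟨a Y.1 Y.2, ha Y.1 Y.2⟩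
    let y : ℕ → {Y // C' Y} := Nat.rec ⟨_, hM⟩ fun _ Y => ⟨b Y.1 Y.2, hb Y.1 Y.2⟩
    have hx : ∀ n, Link A W (x (n + 1)).1 (x n).1 := fun n => hal _ _
    have hy : ∀ n, Link A W (y n).1 (y (n + 1)).1 := fun n => hbl _ _
    let X : ℤ → ModuleCat.{u} A := fun k => match k with
      | Int.ofNat n => (y n).1
      | Int.negSucc n => (x (n + 1)).1
    refine ⟨X, ⟨LinearEquiv.refl _ _⟩, fun k => ?_⟩
    match k with
    | Int.ofNat n => exact hy n
    | Int.negSucc 0 => exact hx 0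
    | Int.negSucc (n + 1) => exact hx (n + 1)

/-- Compare the kernel `N'` of a projective precover of a retract `N` of `Z` with a syzygy `Z'`
of `Z`. -/
lemma IsLink.exists_retract {Z' Q Z : Type u} [AddCommGroup Z'] [Module A Z'] [AddCommGroup Q]
    [Module A Q] [AddCommGroup Z] [Module A Z] [Module.Projective A Q] {i : Z' →ₗ[A] Q}
    {p : Q →ₗ[A] Z} (h : IsLink W i p) {N' P N : Type u} [AddCommGroup N'] [Module A N']
    [AddCommGroup P] [Module A P] [AddCommGroup N] [Module A N] [Module.Projective A P]
    {j : N' →ₗ[A] P} {π : P →ₗ[A] N} (hj : Injective j) (hπ : Surjective π) (he : Exact j π)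
    (s : N →ₗ[A] Z) (r : Z →ₗ[A] N) (hrs : r ∘ₗ s = LinearMap.id) :
    IsLink W j π ∧ ∃ (s' : N' →ₗ[A] (Z' × P)) (r' : (Z' × P) →ₗ[A] N'),
      r' ∘ₗ s' = LinearMap.id := by
  have hrs' : ∀ x, r (s x) = x := LinearMap.congr_fun hrs
  have hpi : ∀ x, p (i x) = 0 := fun x => (h.exact _).2 ⟨x, rfl⟩
  have hπj : ∀ x, π (j x) = 0 := fun x => (he _).2 ⟨x, rfl⟩
  obtain ⟨a, ha⟩ := exists_lift_of_range_le (s ∘ₗ π) p fun x => h.surj _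
  obtain ⟨b, hb⟩ := exists_lift_of_range_le (r ∘ₗ p) π fun x => hπ _
  simp only [LinearMap.comp_apply] at ha hb
  obtain ⟨a', ha'⟩ := exists_comp_eq_of_exact h.inj h.exact (a ∘ₗ j) fun x => by
    simp [ha, hπj]
  obtain ⟨b', hb'⟩ := exists_comp_eq_of_exact hj he (b ∘ₗ i) fun x => by
    simp [hb, hpi]
  obtain ⟨c, hc⟩ := exists_comp_eq_of_exact hj he (LinearMap.id - b ∘ₗ a) fun x => by
    simp [hb, ha, hrs']
  simp only [LinearMap.comp_apply, LinearMap.sub_apply, LinearMap.id_apply] at ha' hb' hc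
  have key : ∀ x, b' (a' x) + c (j x) = x := fun x => hj (by
    rw [map_add, hb', ha', hc, add_sub_cancel])
  refine ⟨⟨hj, hπ, he, fun g => ?_⟩, a'.prod j, b'.coprod c, LinearMap.ext fun x => ?_⟩
  · obtain ⟨k, hk⟩ := h.extend (g ∘ₗ b')
    refine ⟨k ∘ₗ a + g ∘ₗ c, fun x => ?_⟩
    simp only [LinearMap.add_apply, LinearMap.comp_apply] at hk ⊢
    rw [← ha', hk, ← map_add, key]
  · simpa using key x

/-- The kernel of a map from a finitely generated projective module onto a member of a chain of
links is a member of a chain of links. -/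
lemma HasChain.ker {N P M : Type u} [AddCommGroup N] [Module A N] [AddCommGroup P] [Module A P]
    [AddCommGroup M] [Module A M] [Module.Finite A P] [Module.Projective A P] {j : N →ₗ[A] P}
    {π : P →ₗ[A] M} (hj : Injective j) (hπ : Surjective π) (he : Exact j π)
    (hM : HasChain A W M) : IsLink W j π ∧ HasChain A W N := by
  obtain ⟨⟨C, hC, hC'⟩, C', hM, hM'⟩ := (hasChain_iff M).1 hM
  obtain ⟨X, hX, Q, _, _, _, _, i, p, hl⟩ := hC' _ hC
  obtain ⟨hlink, s, r, hrs⟩ := hl.exists_retract hj hπ he LinearMap.id LinearMap.id rfl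
  refine ⟨hlink, (hasChain_iff N).2 ⟨⟨fun Y => ∃ X, C X ∧ ∃ Q : ModuleCat.{u} A,
    Module.Finite A Q ∧ Module.Projective A Q ∧ ∃ (s : Y →ₗ[A] X × Q) (r : X × Q →ₗ[A] Y),
      r ∘ₗ s = LinearMap.id, ⟨X, hX, ModuleCat.of A P, ‹_›, ‹_›, s, r, hrs⟩, ?_⟩,
    fun Y => Y = ModuleCat.of A N ∨ C' Y, Or.inl rfl, ?_⟩⟩
  · rintro Y ⟨X, hX, Q, _, _, s, r, hrs⟩
    obtain ⟨X', hX', P', _, _, _, _, i, p, hl⟩ := hC' _ hX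
    have := Link.finite (A := A) (W := W) ⟨P', _, _, ‹_›, ‹_›, i, p, hl⟩
    have : Module.Finite A Y :=
      Module.Finite.of_surjective r fun x => ⟨s x, LinearMap.congr_fun hrs x⟩
    have hl' : IsLink W (LinearMap.inl A P' Q ∘ₗ i) (p.prodMap (LinearMap.id : Q →ₗ[A] Q)) := by
      refine ⟨LinearMap.inl_injective.comp hl.inj, hl.surj.prodMap surjective_id, ?_, fun g => ?_⟩
      · rintro ⟨x, y⟩
        simp only [LinearMap.prodMap_apply, LinearMap.id_apply, Prod.mk_eq_zero, hl.exact x,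
          Set.mem_range, LinearMap.comp_apply, LinearMap.inl_apply, Prod.mk.injEq, eq_comm (b := y),
          exists_and_right]
      · obtain ⟨k, hk⟩ := hl.extend g
        exact ⟨k ∘ₗ LinearMap.fst A P' Q, fun x => by simp [hk]⟩
    obtain ⟨n, f, hf⟩ := Module.Finite.exists_fin' A Y
    obtain ⟨h1, s', r', hrs'⟩ := hl'.exists_retract (j := (LinearMap.ker f).subtype)
      Subtype.val_injective hf (LinearMap.exact_subtype_ker_map f) s r hrs
    exact ⟨ModuleCat.of A (LinearMap.ker f),
      ⟨X', hX', ModuleCat.of A (Fin n → A), inferInstanceAs (Module.Finite A (Fin n → A)),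
        inferInstanceAs (Module.Projective A (Fin n → A)), s', r', hrs'⟩,
      Fin n → A, _, _, inferInstance, inferInstance, _, f, h1⟩
  · rintro Y (rfl | hY)
    · exact ⟨_, Or.inr hM, P, _, _, ‹_›, ‹_›, j, π, hlink⟩
    · obtain ⟨Z, hZ, hl⟩ := hM' _ hY
      exact ⟨Z, Or.inr hZ, hl⟩

end OneRing

section TwoRings

variable {A B W : Type u} [Ring A] [Ring B] [AddCommGroup W] [Module A W] [Module B W]
  [SMulCommClass A B W] [SMulCommClass B A W]

lemma Link.dual (hW : IsRegularBimodule A B W) {X Y Z V : Type u} [AddCommGroup X] [Module A X]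
    [AddCommGroup Y] [Module A Y] [AddCommGroup Z] [Module A Z] [AddCommGroup V] [Module A V]
    (h₁ : Link A W X Y) (h₂ : Link A W Y Z) (h₃ : Link A W Z V) :
    Link B W (Y →ₗ[A] W) (X →ₗ[A] W) := by
  obtain ⟨P, _, _, _, _, i, p, h₁⟩ := h₁
  obtain ⟨Q, _, _, _, _, j, q, h₂⟩ := h₂
  obtain ⟨S, _, _, _, _, k, _, h₃⟩ := h₃
  obtain ⟨_, _⟩ := hW.dual_finite_projective P
  refine ⟨P →ₗ[A] W, _, _, ‹_›, ‹_›, dmap A B W p, dmap A B W i, fun f g hfg => ?_, fun f => ?_,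
    fun f => ?_, fun g => ?_⟩
  · ext x
    obtain ⟨y, rfl⟩ := h₁.surj x
    exact LinearMap.congr_fun hfg y
  · obtain ⟨g, hg⟩ := h₁.extend f
    exact ⟨g, LinearMap.ext hg⟩
  · constructor
    · intro hf
      obtain ⟨g, hg⟩ := exists_comp_eq_of_surjective h₁.surj f fun x hx => by
        obtain ⟨y, rfl⟩ := (h₁.exact x).1 hx
        exact LinearMap.congr_fun hf y
      exact ⟨g, LinearMap.ext hg⟩
    · rintro ⟨g, rfl⟩
      ext x
      simp [(h₁.exact _).2 ⟨x, rfl⟩]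
  · obtain ⟨y, hy⟩ := (hW.dev_bijective Q).2 (g ∘ₗ dmap A B W j)
    have hy' : ∀ f : Q →ₗ[A] W, f y = g (f ∘ₗ j) := LinearMap.congr_fun hy
    have hqy : q y = 0 := h₃.inj ((hW.dev_bijective S).1 (by
      ext f
      have h0 : (f ∘ₗ k ∘ₗ q) ∘ₗ j = 0 := by
        ext x
        simp [(h₂.exact _).2 ⟨x, rfl⟩]
      have := hy' (f ∘ₗ k ∘ₗ q)
      rw [h0, map_zero] at this
      simpa using this))
    obtain ⟨x, rfl⟩ := (h₂.exact y).1 hqy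
    obtain ⟨z, rfl⟩ := h₁.surj x
    refine ⟨dev A B W P z, fun f => ?_⟩
    obtain ⟨f', hf'⟩ := h₂.extend f
    have := hy' f'
    rw [hf', show f' ∘ₗ j = f from LinearMap.ext hf'] at this
    exact this

lemma HasChain.dual (hW : IsRegularBimodule A B W) {M : Type u} [AddCommGroup M] [Module A M]
    (h : HasChain A W M) : HasChain B W (M →ₗ[A] W) := by
  obtain ⟨X, ⟨e⟩, hX⟩ := h
  refine ⟨fun n => ModuleCat.of B (X (-n) →ₗ[A] W), ⟨dcongr B W e.symm⟩, fun n => ?_⟩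
  have key : ∀ m k l t, m + 1 = k → k + 1 = l → l + 1 = t →
      Link B W (X k →ₗ[A] W) (X m →ₗ[A] W) := by
    rintro m _ _ _ rfl rfl rfl
    exact Link.dual hW (hX _) (hX _) (hX _)
  exact key _ _ _ _ (by ring) rfl rfl

lemma TrPres.hasChain (hW : IsRegularBimodule A B W) {M N : Type u} [AddCommGroup M] [Module A M]
    [AddCommGroup N] [Module B N] (T : TrPres A B W M N) (h : HasChain A W M) :
    HasChain B W N := by
  have hpd : ∀ x, T.d x ∈ LinearMap.ker T.p := fun x => (T.exact_p _).2 ⟨x, rfl⟩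
  obtain ⟨l₀, h₀⟩ := HasChain.ker (j := (LinearMap.ker T.p).subtype) Subtype.val_injective
    T.surj_p (LinearMap.exact_subtype_ker_map T.p) h
  let d' := T.d.codRestrict (LinearMap.ker T.p) hpd
  have hd' : Surjective d' := by
    rintro ⟨y, hy⟩
    obtain ⟨x, hx⟩ := (T.exact_p y).1 hy
    exact ⟨x, Subtype.ext hx⟩
  obtain ⟨l₁, h₁⟩ := HasChain.ker (j := (LinearMap.ker d').subtype) Subtype.val_injective
    hd' (LinearMap.exact_subtype_ker_map d') h₀
  obtain ⟨e⟩ := nonempty_equiv_of_ker_eq (g := dmap A B W (LinearMap.ker d').subtype) T.surj_q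
    (fun f => (l₁.extend f).imp fun _ h => LinearMap.ext h) fun f => by
    rw [T.exact_q f]
    constructor
    · rintro ⟨g, rfl⟩
      ext ⟨x, hx⟩
      have : T.d x = 0 := congrArg Subtype.val hx
      simp [this]
    · intro hf
      obtain ⟨g, hg⟩ := exists_comp_eq_of_surjective hd' f fun x hx => LinearMap.congr_fun hf ⟨x, hx⟩
      obtain ⟨k, hk⟩ := l₀.extend g
      exact ⟨k, LinearMap.ext fun x => (hk (d' x)).trans (hg x)⟩
  exact (h₁.dual hW).of_equiv e

/-- Gorenstein projectivity is preserved by the transpose. -/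
lemma TrPres.isGP_iff [IsNoetherianRing A] (hW : IsRegularBimodule A B W) {M N : Type u}
    [AddCommGroup M] [Module A M] [AddCommGroup N] [Module B N] (T : TrPres A B W M N) :
    IsGP A M ↔ IsGP B N := by
  obtain ⟨α⟩ := hW.exists_equiv
  obtain ⟨β⟩ := hW.symm.exists_equiv
  obtain ⟨S⟩ := T.nonempty_swap hW
  rw [isGP_iff_hasChain, isGP_iff_hasChain]
  exact ⟨fun h => (T.hasChain hW (h.congr α)).congr β.symm,
    fun h => (S.hasChain hW.symm (h.congr β)).congr α.symm⟩

end TwoRings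

end GorensteinProjective

section Duality

/-- A perfect `K`-valued pairing between an `A`-module and a `B`-module, balanced along a bijection
`φ` (the passage to the opposite ring). Perfect pairings encode the `K`-duality between modules over
`A` and over `B` without singling out one of the two sides. -/
structure DualPair (K : Type u) [Field K] {A B : Type u} [Ring A] [Ring B] [Algebra K A]
    [Algebra K B] (φ : A ≃ B) (X Y : Type u) [AddCommGroup X] [Module A X] [AddCommGroup Y]
    [Module B Y] where
  form : X →+ Y →+ K
  smul_left : ∀ k x y, form (algebraMap K A k • x) y = k * form x y
  smul_right : ∀ k x y, form x (algebraMap K B k • y) = k * form x y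
  balanced : ∀ a x y, form (a • x) y = form x (φ a • y)
  ext_left : ∀ x, (∀ y, form x y = 0) → x = 0
  ext_right : ∀ y, (∀ x, form x y = 0) → y = 0
  rep_left : ∀ l : X →+ K, (∀ k x, l (algebraMap K A k • x) = k * l x) → ∃ y, ∀ x, form x y = l x
  rep_right : ∀ l : Y →+ K, (∀ k y, l (algebraMap K B k • y) = k * l y) → ∃ x, ∀ y, form x y = l y

namespace DualPair

variable {K : Type u} [Field K] {A B : Type u} [Ring A] [Ring B] [Algebra K A] [Algebra K B]
  {φ : A ≃ B}
  {X Y X' Y' X'' Y'' : Type u} [AddCommGroup X] [Module A X] [AddCommGroup Y] [Module B Y]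
  [AddCommGroup X'] [Module A X'] [AddCommGroup Y'] [Module B Y']
  [AddCommGroup X''] [Module A X''] [AddCommGroup Y''] [Module B Y'']

/-- Exchange the two sides of a perfect pairing. -/
def swap (S : DualPair K φ X Y) : DualPair K φ.symm Y X where
  form := S.form.flip
  smul_left k y x := S.smul_right k x y
  smul_right k y x := S.smul_left k x y
  balanced b y x := by simp [S.balanced]
  ext_left := S.ext_right
  ext_right := S.ext_left
  rep_left := S.rep_right
  rep_right := S.rep_left

@[simp] lemma swap_form (S : DualPair K φ X Y) (y : Y) (x : X) : S.swap.form y x = S.form x y := rfl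

lemma eq_left (S : DualPair K φ X Y) {x x' : X} (h : ∀ y, S.form x y = S.form x' y) : x = x' :=
  sub_eq_zero.1 (S.ext_left _ fun y => by simp [h])

lemma eq_right (S : DualPair K φ X Y) {y y' : Y} (h : ∀ x, S.form x y = S.form x y') : y = y' :=
  S.swap.eq_left h

/-- Maps `f : X → X'` and `f' : Y' → Y` are adjoint. -/
def IsAdjoint (S : DualPair K φ X Y) (S' : DualPair K φ X' Y') (f : X →ₗ[A] X')
    (f' : Y' →ₗ[B] Y) : Prop :=
  ∀ x y, S'.form (f x) y = S.form x (f' y)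

variable {S : DualPair K φ X Y} {S' : DualPair K φ X' Y'} {S'' : DualPair K φ X'' Y''}

lemma IsAdjoint.swap {f : X →ₗ[A] X'} {f' : Y' →ₗ[B] Y} (h : IsAdjoint S S' f f') :
    IsAdjoint S'.swap S.swap f' f := fun y x => (h x y).symm

variable (S S') in
lemma exists_isAdjoint (f : X →ₗ[A] X') : ∃ f' : Y' →ₗ[B] Y, IsAdjoint S S' f f' := by
  have key : ∀ y, ∃ z, ∀ x, S.form x z = S'.form (f x) y := fun y =>
    S.rep_left ((S'.form.flip y).comp f.toAddMonoidHom) fun k x => by simp [S'.smul_left]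
  choose F hF using key
  refine ⟨{ toFun := F, map_add' := fun y z => ?_, map_smul' := fun b y => ?_ }, fun x y =>
    (hF y x).symm⟩
  · exact S.eq_right fun x => by simp [hF]
  · refine S.eq_right fun x => ?_
    obtain ⟨a, rfl⟩ := φ.surjective b
    rw [hF, RingHom.id_apply, ← S.balanced, hF, LinearMap.map_smul f, S'.balanced]

variable (S S') in
lemma exists_isAdjoint_left (f' : Y' →ₗ[B] Y) : ∃ f : X →ₗ[A] X', IsAdjoint S S' f f' := by
  obtain ⟨f, hf⟩ := exists_isAdjoint S'.swap S.swap f'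
  exact ⟨f, fun x y => (hf y x).symm⟩

lemma exists_factor {f : X' →ₗ[A] X} {l : X' →+ K}
    (hl : ∀ k x, l (algebraMap K A k • x) = k * l x) (h : ∀ x, f x = 0 → l x = 0) :
    ∃ m : X →+ K, (∀ k x, m (algebraMap K A k • x) = k * m x) ∧ ∀ x, m (f x) = l x := by
  let _ : Module K X := Module.compHom X (algebraMap K A)
  let _ : Module K X' := Module.compHom X' (algebraMap K A)
  let g : X' →ₗ[K] X := { f with map_smul' := fun k x => map_smul f (algebraMap K A k) x }
  let l' : Module.Dual K X' := { l with map_smul' := hl }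
  have : l' ∈ LinearMap.range g.dualMap := by
    rw [LinearMap.range_dualMap_eq_dualAnnihilator_ker, Submodule.mem_dualAnnihilator]
    exact h
  obtain ⟨m, hm⟩ := this
  exact ⟨m.toAddMonoidHom, fun k x => map_smul m k x, LinearMap.congr_fun hm⟩

lemma IsAdjoint.exists_of_vanish {f : X →ₗ[A] X'} {f' : Y' →ₗ[B] Y} (h : IsAdjoint S S' f f')
    (y : Y) (hy : ∀ x, f x = 0 → S.form x y = 0) : ∃ y', f' y' = y := by
  obtain ⟨m, hm, hmf⟩ := exists_factor (f := f) (l := S.form.flip y)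
    (fun k x => S.smul_left k x y) hy
  obtain ⟨y', hy'⟩ := S'.rep_left m hm
  exact ⟨y', S.eq_right fun x => by rw [← h, hy', hmf]; rfl⟩

lemma IsAdjoint.surjective {f : X →ₗ[A] X'} {f' : Y' →ₗ[B] Y} (h : IsAdjoint S S' f f')
    (hf : Injective f) : Surjective f' := fun y =>
  h.exists_of_vanish y fun x hx => by simp [(map_eq_zero_iff f hf).1 hx]

lemma IsAdjoint.injective {f : X →ₗ[A] X'} {f' : Y' →ₗ[B] Y} (h : IsAdjoint S S' f f')
    (hf : Surjective f) : Injective f' := by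
  rw [injective_iff_map_eq_zero]
  refine fun y hy => S'.ext_right y fun x => ?_
  obtain ⟨x, rfl⟩ := hf x
  rw [h, hy, map_zero]

lemma IsAdjoint.exact {f : X →ₗ[A] X'} {f' : Y' →ₗ[B] Y} (h : IsAdjoint S S' f f')
    {g : X' →ₗ[A] X''} {g' : Y'' →ₗ[B] Y'} (h' : IsAdjoint S' S'' g g') (he : Exact f g) :
    Exact g' f' := by
  intro y
  constructor
  · refine fun hy => h'.exists_of_vanish y fun x hx => ?_
    obtain ⟨x, rfl⟩ := (he x).1 hx
    rw [h, hy, map_zero]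
  · rintro ⟨y, rfl⟩
    exact S.eq_right fun x => by rw [← h, ← h', (he _).2 ⟨x, rfl⟩]; simp

lemma IsAdjoint.comp {f : X →ₗ[A] X'} {f' : Y' →ₗ[B] Y} (h : IsAdjoint S S' f f')
    {g : X' →ₗ[A] X''} {g' : Y'' →ₗ[B] Y'} (h' : IsAdjoint S' S'' g g') :
    IsAdjoint S S'' (g ∘ₗ f) (f' ∘ₗ g') := fun x y => by
  simp [← h x, ← h' (f x)]

lemma IsAdjoint.eq {f g : X →ₗ[A] X'} {f' : Y' →ₗ[B] Y} (h : IsAdjoint S S' f f')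
    (hg : IsAdjoint S S' g f') (x : X) : f x = g x :=
  S'.eq_left fun y => by rw [h, hg]

lemma IsAdjoint.eq_right {f : X →ₗ[A] X'} {f' g' : Y' →ₗ[B] Y} (h : IsAdjoint S S' f f')
    (hg : IsAdjoint S S' f g') (y : Y') : f' y = g' y :=
  hg.swap.eq h.swap y |>.symm

lemma isAdjoint_id : IsAdjoint S S LinearMap.id LinearMap.id := fun _ _ => rfl

lemma nonempty_equiv (S : DualPair K φ X Y) (S' : DualPair K φ X' Y') (e : X ≃ₗ[A] X') : Nonempty (Y ≃ₗ[B] Y') := by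
  obtain ⟨f, hf⟩ := exists_isAdjoint S S' e.toLinearMap
  obtain ⟨g, hg⟩ := exists_isAdjoint S' S e.symm.toLinearMap
  refine ⟨LinearEquiv.ofLinearMap g f (LinearMap.ext fun y => ?_) (LinearMap.ext fun y => ?_)⟩
  · refine (hg.comp hf).eq_right ?_ y
    simpa using isAdjoint_id
  · refine (hf.comp hg).eq_right ?_ y
    simpa using isAdjoint_id

/-- Finite products of perfect pairings. -/
def pi {ι : Type} [Fintype ι] [DecidableEq ι] {X Y : ι → Type u} [∀ i, AddCommGroup (X i)]
    [∀ i, Module A (X i)] [∀ i, AddCommGroup (Y i)] [∀ i, Module B (Y i)]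
    (S : ∀ i, DualPair K φ (X i) (Y i)) : DualPair K φ (∀ i, X i) (∀ i, Y i) where
  form := AddMonoidHom.mk' (fun x => AddMonoidHom.mk' (fun y => ∑ i, (S i).form (x i) (y i))
    fun y y' => by simp [Finset.sum_add_distrib]) fun x x' => by
      ext y; simp [Finset.sum_add_distrib]
  smul_left k x y := by simp [smul_left, Finset.mul_sum]
  smul_right k x y := by simp [smul_right, Finset.mul_sum]
  balanced a x y := by simp [balanced]
  ext_left x h := funext fun i => (S i).ext_left _ fun y => by
    have := h (Pi.single i y)
    rwa [AddMonoidHom.mk'_apply, AddMonoidHom.mk'_apply, Finset.sum_eq_single i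
      (fun j _ hj => by simp [Pi.single_eq_of_ne hj]) (by simp), Pi.single_eq_same] at this
  ext_right y h := funext fun i => (S i).ext_right _ fun x => by
    have := h (Pi.single i x)
    rwa [AddMonoidHom.mk'_apply, AddMonoidHom.mk'_apply, Finset.sum_eq_single i
      (fun j _ hj => by simp [Pi.single_eq_of_ne hj]) (by simp), Pi.single_eq_same] at this
  rep_left l hl := by
    choose y hy using fun i => (S i).rep_left (l.comp (AddMonoidHom.single X i)) fun k x => by
      simp [Pi.single_smul, hl]
    refine ⟨y, fun x => ?_⟩
    conv_rhs => rw [← Finset.univ_sum_single x]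
    simp [hy]
  rep_right l hl := by
    choose x hx using fun i => (S i).rep_right (l.comp (AddMonoidHom.single Y i)) fun k x => by
      simp [Pi.single_smul, hl]
    refine ⟨x, fun y => ?_⟩
    conv_rhs => rw [← Finset.univ_sum_single y]
    simp [hx]

/-- A direct summand on one side of a perfect pairing is paired with a direct summand on the
other side. -/
lemma exists_of_retract (S : DualPair K φ X Y) (i : X' →ₗ[A] X) (r : X →ₗ[A] X')
    (hri : r ∘ₗ i = LinearMap.id) :
    ∃ (Y' : Type u) (_ : AddCommGroup Y') (_ : Module B Y'), Nonempty (DualPair K φ X' Y') := by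
  obtain ⟨e, he⟩ := exists_isAdjoint S S (i ∘ₗ r)
  have hri' : ∀ x, r (i x) = x := LinearMap.congr_fun hri
  have he' : ∀ x y, S.form (i (r x)) y = S.form x (e y) := he
  have hee : ∀ y, e (e y) = e y := fun y => S.eq_right fun x => by
    rw [← he', ← he', hri', he']
  refine ⟨LinearMap.range e, inferInstance, inferInstance, ⟨{
    form := (S.form.compr₂ (AddMonoidHom.id K)).comp i.toAddMonoidHom |>.compl₂
      (LinearMap.range e).subtype.toAddMonoidHom
    smul_left := fun k x y => ?_
    smul_right := fun k x y => ?_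
    balanced := fun a x y => ?_
    ext_left := fun x h => ?_
    ext_right := ?_
    rep_left := fun l hl => ?_
    rep_right := fun l hl => ?_ }⟩⟩
  · simp [S.smul_left]
  · simp [S.smul_right]
  · simp [S.balanced]
  · have : i x = 0 := S.ext_left _ fun y => by
      have := h ⟨e y, y, rfl⟩
      simpa [← he', hri'] using this
    rw [← hri' x, this, map_zero]
  · rintro ⟨_, y, rfl⟩ h
    refine Subtype.ext (S.ext_right _ fun x => ?_)
    calc S.form x (e y) = S.form (i (r x)) (e y) := by rw [he', hee]
      _ = 0 := h (r x)
  · obtain ⟨y, hy⟩ := S.rep_left (l.comp r.toAddMonoidHom) fun k x => by simp [hl]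
    refine ⟨⟨e y, y, rfl⟩, fun x => ?_⟩
    simp [← he', hri', hy]
  · obtain ⟨x, hx⟩ := S.rep_right (l.comp e.rangeRestrict.toAddMonoidHom) fun k y => by
      simp [hl]
    refine ⟨r x, ?_⟩
    rintro ⟨_, y, rfl⟩
    refine (he' x (e y)).trans ?_
    rw [hx]
    exact congrArg l (Subtype.ext (by simp [hee]))

end DualPair

lemma isSumCorrespondence_dualPair {K : Type u} [Field K] {A B : Type u} [Ring A] [Ring B]
    [Algebra K A] [Algebra K B] (φ : A ≃ B) :
    IsSumCorrespondence A B (fun X Y _ _ _ _ => Nonempty (DualPair K φ X Y)) where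
  iso_right := fun ⟨S⟩ ⟨S'⟩ ⟨e⟩ => S.nonempty_equiv S' e
  iso_left := fun ⟨S⟩ ⟨S'⟩ ⟨e⟩ => S.swap.nonempty_equiv S'.swap e
  pi := fun S => ⟨DualPair.pi fun i => (S i).some⟩
  summand_left := fun i r hri ⟨S⟩ => S.exists_of_retract i r hri
  summand_right := fun i r hri ⟨S⟩ => by
    obtain ⟨X', _, _, ⟨S'⟩⟩ := S.swap.exists_of_retract i r hri
    exact ⟨X', _, _, ⟨S'.swap⟩⟩

section Standard

variable (R : Type u) [Ring R] (K : Type u) [Field K] [Algebra K R]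

/-- The pairing of a finite dimensional `Rᵐᵒᵖ`-module with its `K`-dual. -/
def opDualPair (N : Type u) [AddCommGroup N] [Module Rᵐᵒᵖ N] [Module K N]
    [IsScalarTower K Rᵐᵒᵖ N] [FiniteDimensional K N] :
    DualPair K (opEquiv : R ≃ Rᵐᵒᵖ) (OpDual R K N) N where
  form := AddMonoidHom.mk' (fun f => (OpDual.toL R K N f).toAddMonoidHom) fun f g => rfl
  smul_left k f n := by
    change OpDual.toL R K N f (op (algebraMap K R k) • n) = k * OpDual.toL R K N f n
    rw [← MulOpposite.algebraMap_apply, algebraMap_smul, map_smul, smul_eq_mul]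
  smul_right k f n := by
    change OpDual.toL R K N f (algebraMap K Rᵐᵒᵖ k • n) = k * OpDual.toL R K N f n
    rw [algebraMap_smul, map_smul, smul_eq_mul]
  balanced _ _ _ := rfl
  ext_left f h := LinearMap.ext (f := OpDual.toL R K N f) (g := 0) h
  ext_right n h := (Module.forall_dual_apply_eq_zero_iff K n).1 h
  rep_left l hl := by
    let l' : Module.Dual K (Module.Dual K N) :=
      { toFun := l
        map_add' := l.map_add
        map_smul' := fun k f => (congrArg l (LinearMap.ext fun n => by
          change k * f n = f (op (algebraMap K R k) • n)
          rw [← MulOpposite.algebraMap_apply, algebraMap_smul, map_smul, smul_eq_mul])).trans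
            (hl k f) }
    exact ⟨(Module.evalEquiv K N).symm l', fun f => by
      exact Module.apply_evalEquiv_symm_apply K N f l'⟩
  rep_right l hl :=
    let l' : N →ₗ[K] K :=
      { toFun := l
        map_add' := l.map_add
        map_smul' := fun k n => (congrArg l (algebraMap_smul Rᵐᵒᵖ k n).symm).trans (hl k n) }
    ⟨l', fun _ => rfl⟩

/-- The pairing of a finite dimensional `R`-module with its `K`-dual. -/
def lDualPair (M : Type u) [AddCommGroup M] [Module R M] [Module K M]
    [IsScalarTower K R M] [FiniteDimensional K M] :
    DualPair K (opEquiv : R ≃ Rᵐᵒᵖ) M (LDual R K M) where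
  form := AddMonoidHom.flip <|
    AddMonoidHom.mk' (fun f => (LDual.toL R K M f).toAddMonoidHom) fun f g => rfl
  smul_left k n f := by
    change LDual.toL R K M f (algebraMap K R k • n) = k * LDual.toL R K M f n
    rw [algebraMap_smul, map_smul, smul_eq_mul]
  smul_right k n f := by
    change LDual.toL R K M f (algebraMap K R k • n) = k * LDual.toL R K M f n
    rw [algebraMap_smul, map_smul, smul_eq_mul]
  balanced _ _ _ := rfl
  ext_right f h := LinearMap.ext (f := LDual.toL R K M f) (g := 0) h
  ext_left n h := (Module.forall_dual_apply_eq_zero_iff K n).1 h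
  rep_right l hl := by
    let l' : Module.Dual K (Module.Dual K M) :=
      { toFun := l
        map_add' := l.map_add
        map_smul' := fun k f => (congrArg l (LinearMap.ext fun n => by
          change k * f n = f (algebraMap K R k • n)
          rw [algebraMap_smul, map_smul, smul_eq_mul])).trans (hl k f) }
    exact ⟨(Module.evalEquiv K M).symm l', fun f => by
      exact Module.apply_evalEquiv_symm_apply K M f l'⟩
  rep_left l hl :=
    let l' : M →ₗ[K] K :=
      { toFun := l
        map_add' := l.map_add
        map_smul' := fun k n => (congrArg l (algebraMap_smul R k n).symm).trans (hl k n) }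
    ⟨l', fun _ => rfl⟩

variable {R K}

lemma exists_tower (A : Type u) [Ring A] [Algebra K A] (M : Type u) [AddCommGroup M]
    [Module A M] : ∃ _ : Module K M, IsScalarTower K A M :=
  letI := Module.compHom M (algebraMap K A)
  ⟨inferInstance, ⟨fun k a m => by rw [Algebra.smul_def, mul_smul]; rfl⟩⟩

lemma exists_dualPair_left [FiniteDimensional K R] (M : Type u) [AddCommGroup M] [Module R M]
    [Module.Finite R M] : ∃ (N : Type u) (_ : AddCommGroup N) (_ : Module Rᵐᵒᵖ N),
      Module.Finite Rᵐᵒᵖ N ∧ Nonempty (DualPair K (opEquiv : R ≃ Rᵐᵒᵖ) M N) := by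
  obtain ⟨_, _⟩ := exists_tower (K := K) R M
  have : FiniteDimensional K M := Module.Finite.trans R M
  have : FiniteDimensional K (LDual R K M) := inferInstanceAs (FiniteDimensional K (M →ₗ[K] K))
  exact ⟨LDual R K M, inferInstance, inferInstance,
    Module.Finite.of_restrictScalars_finite K Rᵐᵒᵖ _, ⟨lDualPair R K M⟩⟩

lemma exists_dualPair_right [FiniteDimensional K R] (N : Type u) [AddCommGroup N]
    [Module Rᵐᵒᵖ N] [Module.Finite Rᵐᵒᵖ N] :
    ∃ (M : Type u) (_ : AddCommGroup M) (_ : Module R M),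
      Module.Finite R M ∧ Nonempty (DualPair K (opEquiv : R ≃ Rᵐᵒᵖ) M N) := by
  obtain ⟨_, _⟩ := exists_tower (K := K) Rᵐᵒᵖ N
  have : FiniteDimensional K Rᵐᵒᵖ := Module.Finite.equiv (opLinearEquiv K)
  have : FiniteDimensional K N := Module.Finite.trans Rᵐᵒᵖ N
  have : FiniteDimensional K (OpDual R K N) := inferInstanceAs (FiniteDimensional K (N →ₗ[K] K))
  exact ⟨OpDual R K N, inferInstance, inferInstance,
    Module.Finite.of_restrictScalars_finite K R _, ⟨opDualPair R K N⟩⟩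

variable {M N : Type u} [AddCommGroup M] [Module R M] [AddCommGroup N] [Module Rᵐᵒᵖ N]

lemma DualPair.injective_of_projective [FiniteDimensional K R]
    (S : DualPair K (opEquiv : R ≃ Rᵐᵒᵖ) M N) [Module.Projective Rᵐᵒᵖ N] :
    Module.Injective R M := by
  have : IsNoetherianRing R := isNoetherian_of_tower K inferInstance
  refine Module.Baer.injective fun I g => ?_
  obtain ⟨I', _, _, -, ⟨T⟩⟩ := exists_dualPair_left (K := K) (R := R) I
  obtain ⟨R', _, _, -, ⟨U⟩⟩ := exists_dualPair_left (K := K) (R := R) R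
  obtain ⟨f', hf⟩ := exists_isAdjoint T U I.subtype
  obtain ⟨g', hg⟩ := exists_isAdjoint T S g
  have hs := hf.surjective Subtype.val_injective
  obtain ⟨h', hh'⟩ := Module.projective_lifting_property f' g' hs
  obtain ⟨h, hh⟩ := exists_isAdjoint_left U S h'
  refine ⟨h, fun x hx => ?_⟩
  refine (hf.comp hh).eq (g := g) ?_ ⟨x, hx⟩
  rwa [hh']

lemma DualPair.projective_of_injective [FiniteDimensional K R] [Module.Finite Rᵐᵒᵖ N]
    (S : DualPair K (opEquiv : R ≃ Rᵐᵒᵖ) M N) [Module.Injective R M] :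
    Module.Projective Rᵐᵒᵖ N := by
  obtain ⟨n, π, hπ⟩ := Module.Finite.exists_fin' Rᵐᵒᵖ N
  obtain ⟨F, _, _, -, ⟨T⟩⟩ := exists_dualPair_right (K := K) (R := R) (Fin n → Rᵐᵒᵖ)
  obtain ⟨i, hi⟩ := exists_isAdjoint_left S T π
  obtain ⟨r, hr⟩ := Module.Injective.out i (hi.swap.injective hπ) LinearMap.id
  obtain ⟨s, hs⟩ := exists_isAdjoint T S r
  refine Module.Projective.of_split s π (LinearMap.ext fun y => (hi.comp hs).eq_right ?_ y)
  rw [show r ∘ₗ i = LinearMap.id from LinearMap.ext hr]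
  exact isAdjoint_id

end Standard

end Duality

section GorensteinInjective

/-- A short exact sequence `0 → X → I → Y → 0` such that all maps `E → Y` lift to `I`. -/
structure IsCoLink {A : Type u} [Ring A] (E : Type u) [AddCommGroup E] [Module A E]
    {X I Y : Type u} [AddCommGroup X] [Module A X] [AddCommGroup I] [Module A I] [AddCommGroup Y]
    [Module A Y] (i : X →ₗ[A] I) (p : I →ₗ[A] Y) : Prop where
  inj : Injective i
  surj : Surjective p
  exact : Exact i p
  lift : ∀ g : E →ₗ[A] Y, ∃ h : E →ₗ[A] I, ∀ x, p (h x) = g x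

/-- There is a short exact sequence `0 → X → I → Y → 0` with `I` finitely generated injective
such that all maps `E → Y` lift to `I`. -/
def CoLink (A : Type u) [Ring A] (E : Type u) [AddCommGroup E] [Module A E] (X Y : Type u)
    [AddCommGroup X] [Module A X] [AddCommGroup Y] [Module A Y] : Prop :=
  ∃ (I : Type u) (_ : AddCommGroup I) (_ : Module A I), Module.Finite A I ∧
    Module.Injective A I ∧ ∃ (i : X →ₗ[A] I) (p : I →ₗ[A] Y), IsCoLink E i p

/-- `M` occurs in a doubly infinite chain of colinks. -/
def HasCoChain (A : Type u) [Ring A] (E : Type u) [AddCommGroup E] [Module A E] (M : Type u)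
    [AddCommGroup M] [Module A M] : Prop :=
  ∃ X : ℤ → ModuleCat.{u} A, Nonempty (M ≃ₗ[A] X 0) ∧ ∀ n, CoLink A E (X n) (X (n + 1))

variable {K : Type u} [Field K]

lemma isGI_iff_hasCoChain {R : Type u} [Ring R] [Algebra K R] (M : Type u) [AddCommGroup M]
    [Module R M] : IsGI R K M ↔ HasCoChain R (OpDual R K R) M := by
  constructor
  · rintro ⟨I, _, _, d, hf, hI, hd, hdual, ⟨e⟩⟩
    have key : ∀ k n, n + 1 = k → Nonempty (LinearMap.range (d n) ≃ₗ[R] LinearMap.ker (d k)) := by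
      rintro _ n rfl
      exact ⟨LinearEquiv.ofEq _ _ (LinearMap.exact_iff.1 (hd n)).symm⟩
    obtain ⟨f⟩ := key 0 (-1) rfl
    refine ⟨fun n => ModuleCat.of R (LinearMap.ker (d n)), ⟨e ≪≫ₗ f⟩, fun n => ?_⟩
    refine ⟨I n, _, _, hf _, hI _, (LinearMap.ker (d n)).subtype,
      (d n).codRestrict (LinearMap.ker (d (n + 1))) fun x => (hd _ _).2 ⟨x, rfl⟩,
      Subtype.val_injective, ?_, ?_, fun g => ?_⟩
    · rintro ⟨y, hy⟩
      obtain ⟨x, hx⟩ := (hd _ _).1 hy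
      exact ⟨x, Subtype.ext hx⟩
    · intro x
      rw [Subtype.ext_iff]
      exact ⟨fun h => ⟨⟨x, h⟩, rfl⟩, by rintro ⟨y, rfl⟩; exact y.2⟩
    · obtain ⟨h, hh⟩ := (hdual n ((LinearMap.ker (d (n + 1))).subtype ∘ₗ g)).1
        (LinearMap.ext fun x => (g x).2)
      exact ⟨h, fun x => Subtype.ext (LinearMap.congr_fun hh x)⟩
  · rintro ⟨X, ⟨e⟩, hX⟩
    choose I _ _ hf hI i p h using hX
    refine ⟨I, inferInstance, inferInstance, fun n => i (n + 1) ∘ₗ p n, hf, hI, fun n y => ?_,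
      fun n g => ?_, ?_⟩
    · rw [LinearMap.comp_apply, (map_eq_zero_iff _ (h (n + 1 + 1)).inj), (h (n + 1)).exact,
        LinearMap.coe_comp, (h n).surj.range_comp]
    · constructor
      · intro hg
        obtain ⟨g', hg'⟩ := exists_comp_eq_of_exact (h (n + 1)).inj (h (n + 1)).exact g
          fun x => (h (n + 1 + 1)).inj ((LinearMap.congr_fun hg x).trans (map_zero _).symm)
        obtain ⟨k, hk⟩ := (h n).lift g'
        exact ⟨k, LinearMap.ext fun x => (congrArg _ (hk x)).trans (hg' x)⟩
      · rintro ⟨k, rfl⟩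
        ext x
        change i _ (p _ (i _ (p n (k x)))) = 0
        rw [((h (n + 1)).exact _).2 ⟨_, rfl⟩, map_zero]
    · have key : ∀ k n, n + 1 = k → Nonempty (X k ≃ₗ[R] LinearMap.range (i (n + 1) ∘ₗ p n)) := by
        rintro _ n rfl
        exact ⟨LinearEquiv.ofInjective _ (h (n + 1)).inj ≪≫ₗ LinearEquiv.ofEq _ _
          (LinearMap.range_comp_of_range_eq_top _ (LinearMap.range_eq_top.2 (h n).surj)).symm⟩
      obtain ⟨f⟩ := key 0 (-1) rfl
      exact ⟨e ≪≫ₗ f⟩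

section Adjoint

variable {A B : Type u} [Ring A] [Ring B] [Algebra K A] [Algebra K B] {φ : A ≃ B}
  {X P Y X' P' Y' E W : Type u} [AddCommGroup X] [Module B X] [AddCommGroup P] [Module B P]
  [AddCommGroup Y] [Module B Y] [AddCommGroup X'] [Module A X'] [AddCommGroup P'] [Module A P']
  [AddCommGroup Y'] [Module A Y'] [AddCommGroup E] [Module A E] [AddCommGroup W] [Module B W]
  {S : DualPair K φ X' X} {T : DualPair K φ P' P} {U : DualPair K φ Y' Y}
  {i : X →ₗ[B] P} {p : P →ₗ[B] Y} {i' : P' →ₗ[A] X'} {p' : Y' →ₗ[A] P'}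

open DualPair

lemma IsLink.isCoLink (h : IsLink W i p) (V : DualPair K φ E W) (hi : IsAdjoint T S i' i)
    (hp : IsAdjoint U T p' p) : IsCoLink E p' i' where
  inj := hp.swap.injective h.surj
  surj := hi.swap.surjective h.inj
  exact := hi.swap.exact hp.swap h.exact
  lift g := by
    obtain ⟨g', hg⟩ := exists_isAdjoint V S g
    obtain ⟨k, hk⟩ := h.extend g'
    obtain ⟨k', hk'⟩ := exists_isAdjoint_left V T k
    refine ⟨k', (hk'.comp hi).eq ?_⟩
    rwa [show k ∘ₗ i = g' from LinearMap.ext hk]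

lemma IsCoLink.isLink (h : IsCoLink E p' i') (V : DualPair K φ E W) (hi : IsAdjoint T S i' i)
    (hp : IsAdjoint U T p' p) : IsLink W i p where
  inj := hi.injective h.surj
  surj := hp.surjective h.inj
  exact := hp.exact hi h.exact
  extend g := by
    obtain ⟨g', hg⟩ := exists_isAdjoint_left V S g
    obtain ⟨k, hk⟩ := h.lift g'
    obtain ⟨k', hk'⟩ := exists_isAdjoint V T k
    refine ⟨k', (hk'.comp hi).eq_right ?_⟩
    rwa [show i' ∘ₗ k = g' from LinearMap.ext hk]

end Adjoint

section Opposite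

variable {R : Type u} [Ring R] [Algebra K R] [FiniteDimensional K R]
  {X Y X' Y' E W : Type u} [AddCommGroup X] [Module Rᵐᵒᵖ X] [AddCommGroup Y] [Module Rᵐᵒᵖ Y]
  [AddCommGroup X'] [Module R X'] [AddCommGroup Y'] [Module R Y'] [AddCommGroup E] [Module R E]
  [AddCommGroup W] [Module Rᵐᵒᵖ W]

open DualPair

lemma Link.coLink (h : Link Rᵐᵒᵖ W X Y) (V : DualPair K (opEquiv : R ≃ Rᵐᵒᵖ) E W)
    (S : DualPair K (opEquiv : R ≃ Rᵐᵒᵖ) X' X) (U : DualPair K (opEquiv : R ≃ Rᵐᵒᵖ) Y' Y) :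
    CoLink R E Y' X' := by
  obtain ⟨P, _, _, _, _, i, p, h⟩ := h
  obtain ⟨P', _, _, _, ⟨T⟩⟩ := exists_dualPair_right (K := K) (R := R) P
  obtain ⟨i', hi⟩ := exists_isAdjoint_left T S i
  obtain ⟨p', hp⟩ := exists_isAdjoint_left U T p
  exact ⟨P', _, _, ‹_›, T.injective_of_projective, p', i', h.isCoLink V hi hp⟩

lemma CoLink.link (h : CoLink R E Y' X') (V : DualPair K (opEquiv : R ≃ Rᵐᵒᵖ) E W)
    (S : DualPair K (opEquiv : R ≃ Rᵐᵒᵖ) X' X) (U : DualPair K (opEquiv : R ≃ Rᵐᵒᵖ) Y' Y) :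
    Link Rᵐᵒᵖ W X Y := by
  obtain ⟨P', _, _, _, _, p', i', h⟩ := h
  obtain ⟨P, _, _, _, ⟨T⟩⟩ := exists_dualPair_left (K := K) (R := R) P'
  obtain ⟨i, hi⟩ := exists_isAdjoint T S i'
  obtain ⟨p, hp⟩ := exists_isAdjoint U T p'
  exact ⟨P, _, _, ‹_›, T.projective_of_injective, i, p, h.isLink V hi hp⟩

lemma HasChain.hasCoChain (V : DualPair K (opEquiv : R ≃ Rᵐᵒᵖ) E W) {M N : Type u}
    [AddCommGroup M] [Module R M] [AddCommGroup N] [Module Rᵐᵒᵖ N]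
    (S : DualPair K (opEquiv : R ≃ Rᵐᵒᵖ) M N) (h : HasChain Rᵐᵒᵖ W N) : HasCoChain R E M := by
  obtain ⟨X, ⟨e⟩, hX⟩ := h
  have hfin : ∀ n, Module.Finite Rᵐᵒᵖ (X n) := fun n => by
    obtain ⟨m, rfl⟩ : ∃ m, n = m + 1 := ⟨n - 1, by ring⟩
    exact (hX m).finite
  choose Z _ _ _ hZ using fun n => exists_dualPair_right (K := K) (R := R) (X n)
  refine ⟨fun n => ModuleCat.of R (Z (-n)), S.swap.nonempty_equiv (hZ 0).some.swap e, fun n => ?_⟩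
  have key : ∀ m k, m + 1 = k → CoLink R E (Z k) (Z m) := by
    rintro m _ rfl
    exact (hX m).coLink V (hZ _).some (hZ _).some
  exact key _ _ (by ring)

lemma HasCoChain.hasChain (V : DualPair K (opEquiv : R ≃ Rᵐᵒᵖ) E W) {M N : Type u}
    [AddCommGroup M] [Module R M] [AddCommGroup N] [Module Rᵐᵒᵖ N]
    (S : DualPair K (opEquiv : R ≃ Rᵐᵒᵖ) M N) (h : HasCoChain R E M) : HasChain Rᵐᵒᵖ W N := by
  obtain ⟨X, ⟨e⟩, hX⟩ := h
  have : IsNoetherianRing R := isNoetherian_of_tower K inferInstance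
  have hfin : ∀ n, Module.Finite R (X n) := fun n => by
    obtain ⟨I, _, _, _, _, i, p, h⟩ := hX n
    exact Module.Finite.of_injective i h.inj
  choose Z _ _ _ hZ using fun n => exists_dualPair_left (K := K) (R := R) (X n)
  refine ⟨fun n => ModuleCat.of Rᵐᵒᵖ (Z (-n)), S.nonempty_equiv (hZ 0).some e, fun n => ?_⟩
  have key : ∀ m k, m + 1 = k → Link Rᵐᵒᵖ W (Z k) (Z m) := by
    rintro m _ rfl
    exact (hX m).link V (hZ _).some (hZ _).some
  exact key _ _ (by ring)

/-- The `K`-duality exchanges Gorenstein projective and Gorenstein injective modules. -/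
lemma DualPair.isGP_iff_isGI {M N : Type u} [AddCommGroup M] [Module R M] [AddCommGroup N]
    [Module Rᵐᵒᵖ N] (S : DualPair K (opEquiv : R ≃ Rᵐᵒᵖ) M N) :
    IsGP Rᵐᵒᵖ N ↔ IsGI R K M := by
  obtain ⟨e⟩ := (isRegularBimodule_op R).symm.exists_equiv
  rw [isGP_iff_hasChain, isGI_iff_hasCoChain]
  exact ⟨fun h => (h.congr e).hasCoChain (opDualPair R K R) S,
    fun h => (h.hasChain (opDualPair R K R) S).congr e.symm⟩

end Opposite

end GorensteinInjective

section Rigidity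

variable {K : Type u} [Field K]

/-- Bilinear maps to `K`, balanced along a bijection between the rings of scalars. -/
structure IsBalanced {A B : Type u} [Ring A] [Ring B] [Algebra K A] [Algebra K B] (φ : A ≃ B)
    {M N : Type u} [AddCommGroup M] [Module A M] [AddCommGroup N] [Module B N]
    (β : M →+ N →+ K) : Prop where
  smul_left : ∀ k x y, β (algebraMap K A k • x) y = k * β x y
  smul_right : ∀ k x y, β x (algebraMap K B k • y) = k * β x y
  balanced : ∀ a x y, β (a • x) y = β x (φ a • y)

section

variable {A B C : Type u} [Ring A] [Ring B] [Ring C] [Algebra K A] [Algebra K B] [Algebra K C]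
  {φ : A ≃ B} {M N X Y : Type u} [AddCommGroup M] [Module A M] [AddCommGroup N] [Module B N]
  [AddCommGroup X] [Module A X] [AddCommGroup Y] [Module B Y]

lemma IsBalanced.flip {β : M →+ N →+ K} (h : IsBalanced φ β) : IsBalanced φ.symm β.flip where
  smul_left k y x := h.smul_right k x y
  smul_right k y x := h.smul_left k x y
  balanced b y x := by simp [h.balanced]

lemma forall_isBalanced_flip (h : ∀ β : M →+ N →+ K, IsBalanced φ β → β = 0)
    (β : N →+ M →+ K) (hβ : IsBalanced φ.symm β) : β = 0 := by
  have : β.flip = 0 := h _ hβ.flip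
  ext y x
  exact DFunLike.congr_fun (DFunLike.congr_fun this x) y

lemma DualPair.forall_hom_eq_zero_iff (S : DualPair K φ X Y) :
    (∀ f : M →ₗ[A] X, f = 0) ↔ ∀ β : M →+ Y →+ K, IsBalanced φ β → β = 0 := by
  constructor
  · intro h β hβ
    choose f hf using fun m => S.rep_right (β m) fun k y => hβ.smul_right k m y
    let f' : M →ₗ[A] X :=
      { toFun := f
        map_add' := fun m n => S.eq_left fun y => by simp [hf]
        map_smul' := fun a m => S.eq_left fun y => by simp [hf, S.balanced, hβ.balanced] }
    ext m y
    rw [← hf, show f m = 0 from LinearMap.congr_fun (h f') m]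
    simp
  · intro h f
    have := h (S.form.comp f.toAddMonoidHom) ⟨fun k x y => by simp [S.smul_left],
      fun k x y => by simp [S.smul_right], fun a x y => by simp [S.balanced]⟩
    exact LinearMap.ext fun m => S.ext_left _ fun y =>
      DFunLike.congr_fun (DFunLike.congr_fun this m) y

/-- Transport a perfect pairing along a semilinear bijection. -/
def DualPair.transRight (S : DualPair K φ X Y) {Z : Type u} [AddCommGroup Z] [Module C Z]
    (ψ : B ≃ C) (hψ : ∀ k, ψ (algebraMap K B k) = algebraMap K C k) (ε : Z ≃+ Y)
    (hε : ∀ b z, ε (ψ b • z) = b • ε z) : DualPair K (φ.trans ψ) X Z where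
  form := AddMonoidHom.mk' (fun x => (S.form x).comp ε.toAddMonoidHom) fun x x' => by ext; simp
  smul_left k x z := by simp [S.smul_left]
  smul_right k x z := by simp [← hψ, hε, S.smul_right]
  balanced a x z := by simp [hε, S.balanced]
  ext_left x h := S.ext_left x fun y => by simpa using h (ε.symm y)
  ext_right z h := by simpa using S.ext_right (ε z) h
  rep_left l hl := by
    obtain ⟨y, hy⟩ := S.rep_left l hl
    exact ⟨ε.symm y, fun x => by simp [hy]⟩
  rep_right l hl := by
    obtain ⟨x, hx⟩ := S.rep_right (l.comp ε.symm.toAddMonoidHom) fun k y => by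
      have : ε.symm (algebraMap K B k • y) = algebraMap K C k • ε.symm y := by
        rw [← hψ, AddEquiv.symm_apply_eq, hε, AddEquiv.apply_symm_apply]
      simp [this, hl]
    exact ⟨x, fun z => by simp [hx]⟩

end

namespace MinPres

lemma exact_toTr {R : Type u} [Ring R] {M : Type u} [AddCommGroup M] [Module R M]
    (pr : MinPres R M) : ∃ q : (pr.P₁ →ₗ[R] R) →ₗ[Rᵐᵒᵖ] pr.Tr, Surjective q ∧
      Exact (dmap R Rᵐᵒᵖ R pr.d) q :=
  ⟨(LinearMap.range pr.dualMap).mkQ, Submodule.mkQ_surjective _,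
    LinearMap.exact_map_mkQ_range pr.dualMap⟩

variable {R : Type u} [Ring R] [Algebra K R] [FiniteDimensional K R]

variable (K R) in
lemma finiteDimensional_op : FiniteDimensional K Rᵐᵒᵖ :=
  Module.Finite.equiv (opLinearEquiv K)

variable {M : Type u} [AddCommGroup M] [Module R M]

lemma finite_tr (pr : MinPres R M) : Module.Finite Rᵐᵒᵖ pr.Tr := by
  obtain ⟨q, hq, -⟩ := pr.exact_toTr
  have := pr.fin₁
  have := pr.proj₁
  obtain ⟨_, _⟩ := (isRegularBimodule_op R).dual_finite_projective pr.P₁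
  exact Module.Finite.of_surjective q hq

variable (K) in
lemma finiteDimensional_tr (pr : MinPres R M) : FiniteDimensional K pr.Tr :=
  have := pr.finite_tr
  have := finiteDimensional_op K R
  Module.Finite.trans Rᵐᵒᵖ _

lemma nonempty_trPres [IsNoetherianRing R] [IsArtinianRing R] [IsNoetherianRing Rᵐᵒᵖ]
    (pr : MinPres R M) (hM : NoProjSummand R M) : Nonempty (TrPres R Rᵐᵒᵖ R M pr.Tr) := by
  obtain ⟨q, hq, hdq⟩ := pr.exact_toTr
  have := pr.fin₀
  have := pr.fin₁
  have := pr.proj₀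
  have := pr.proj₁
  exact exists_trPres_of_min (isRegularBimodule_op R) pr.surj pr.exact hq hdq pr.min₀ pr.min₁ hM

variable (K) in
lemma exists_dualPair_tau (pr : MinPres R M) :
    Nonempty (DualPair K (opEquiv : R ≃ Rᵐᵒᵖ) (pr.tau K) pr.Tr) :=
  have := pr.finiteDimensional_tr K
  ⟨opDualPair R K pr.Tr⟩

end MinPres

variable {R : Type u} [Ring R] [Algebra K R] [FiniteDimensional K R]
  {M N : Type u} [AddCommGroup M] [Module R M] [AddCommGroup N] [Module Rᵐᵒᵖ N]

/-- The transpose of the transpose. -/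
lemma TrPres.exists_addEquiv_tr [IsNoetherianRing R] [IsNoetherianRing Rᵐᵒᵖ]
    (T : TrPres R Rᵐᵒᵖ R M N) {N' : Type u} [AddCommGroup N']
    [Module Rᵐᵒᵖ N'] (e : N ≃ₗ[Rᵐᵒᵖ] N') (pr : MinPres Rᵐᵒᵖ N') :
    ∃ ε : M ≃+ pr.Tr, ∀ (r : R) (m : M), ε (r • m) = op (op r) • ε m := by
  obtain ⟨S⟩ := T.nonempty_swap (isRegularBimodule_op R)
  obtain ⟨q, hq, hdq⟩ := pr.exact_toTr
  have := pr.proj₀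
  have := pr.proj₁
  let θ : R ≃ₗ[Rᵐᵒᵖ] Rᵐᵒᵖ :=
    { (opAddEquiv : R ≃+ Rᵐᵒᵖ) with map_smul' := fun _ _ => rfl }
  exact S.exists_addEquiv pr.surj pr.exact hq hdq pr.min₀ pr.min₁ e (fun r => op (op r)) θ
    fun _ _ => rfl

lemma TrPres.isTauRigid_iff (T : TrPres R Rᵐᵒᵖ R M N) (hM : NoProjSummand R M) :
    IsTauRigid R K M ↔
      ∀ β : M →+ N →+ K, IsBalanced (opEquiv : R ≃ Rᵐᵒᵖ) β → β = 0 := by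
  have : IsNoetherianRing R := isNoetherian_of_tower K inferInstance
  have : IsArtinianRing R := isArtinian_of_tower K inferInstance
  have := MinPres.finiteDimensional_op K R
  have : IsNoetherianRing Rᵐᵒᵖ := isNoetherian_of_tower K inferInstance
  have key : ∀ pr : MinPres R M, (∀ f : M →ₗ[R] pr.tau K, f = 0) ↔
      ∀ β : M →+ N →+ K, IsBalanced (opEquiv : R ≃ Rᵐᵒᵖ) β → β = 0 := fun pr => by
    obtain ⟨T'⟩ := pr.nonempty_trPres hM
    obtain ⟨e⟩ := T.nonempty_equiv T' (LinearEquiv.refl R M)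
    obtain ⟨S⟩ := pr.exists_dualPair_tau K
    exact (S.transRight (Equiv.refl _) (fun _ => rfl) e.toAddEquiv
      (map_smul e)).forall_hom_eq_zero_iff
  have := T.finite
  obtain ⟨pr⟩ := exists_minPres (A := R) M
  exact ⟨fun h => (key pr).1 (h pr), fun h pr => (key pr).2 h⟩

lemma TrPres.isTauRigid_op_iff (T : TrPres R Rᵐᵒᵖ R M N) :
    IsTauRigid Rᵐᵒᵖ K N ↔
      ∀ β : M →+ N →+ K, IsBalanced (opEquiv : R ≃ Rᵐᵒᵖ) β → β = 0 := by
  have := MinPres.finiteDimensional_op K R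
  have : IsNoetherianRing R := isNoetherian_of_tower K inferInstance
  have : IsNoetherianRing Rᵐᵒᵖ := isNoetherian_of_tower K inferInstance
  have : IsArtinianRing Rᵐᵒᵖ := isArtinian_of_tower K inferInstance
  have key : ∀ pr : MinPres Rᵐᵒᵖ N, (∀ f : N →ₗ[Rᵐᵒᵖ] pr.tau K, f = 0) ↔
      ∀ β : M →+ N →+ K, IsBalanced (opEquiv : R ≃ Rᵐᵒᵖ) β → β = 0 := fun pr => by
    obtain ⟨ε, hε⟩ := T.exists_addEquiv_tr (LinearEquiv.refl _ _) pr
    obtain ⟨S⟩ := pr.exists_dualPair_tau K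
    have S' : DualPair K (opEquiv : R ≃ Rᵐᵒᵖ).symm (pr.tau K) M :=
      S.transRight (opEquiv.symm.trans opEquiv.symm) (fun _ => rfl) ε fun b m => hε _ m
    rw [S'.forall_hom_eq_zero_iff]
    exact ⟨forall_isBalanced_flip, forall_isBalanced_flip⟩
  obtain ⟨S⟩ := T.nonempty_swap (isRegularBimodule_op R)
  have := S.finite
  obtain ⟨pr⟩ := exists_minPres (A := Rᵐᵒᵖ) N
  exact ⟨fun h => (key pr).1 (h pr), fun h pr => (key pr).2 h⟩

lemma TrPres.isTauInvRigid_iff (T : TrPres R Rᵐᵒᵖ R M N) {X : Type u} [AddCommGroup X]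
    [Module R X] [Module K X] [IsScalarTower K R X] [FiniteDimensional K X]
    (S : DualPair K (opEquiv : R ≃ Rᵐᵒᵖ) X N) :
    IsTauInvRigid R K X ↔
      ∀ β : M →+ N →+ K, IsBalanced (opEquiv : R ≃ Rᵐᵒᵖ) β → β = 0 := by
  have := MinPres.finiteDimensional_op K R
  have : IsNoetherianRing R := isNoetherian_of_tower K inferInstance
  have : IsNoetherianRing Rᵐᵒᵖ := isNoetherian_of_tower K inferInstance
  have : IsArtinianRing Rᵐᵒᵖ := isArtinian_of_tower K inferInstance
  obtain ⟨e⟩ := S.nonempty_equiv (lDualPair R K X) (LinearEquiv.refl R X)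
  have key : ∀ pr : MinPres Rᵐᵒᵖ (LDual R K X), (∀ f : pr.Tr →+ X,
      (∀ (r : R) (x : pr.Tr), f (op (op r) • x) = r • f x) → f = 0) ↔
      ∀ β : M →+ N →+ K, IsBalanced (opEquiv : R ≃ Rᵐᵒᵖ) β → β = 0 := fun pr => by
    obtain ⟨ε, hε⟩ := T.exists_addEquiv_tr e pr
    rw [← S.forall_hom_eq_zero_iff]
    constructor
    · intro h f
      have := h (f.toAddMonoidHom.comp ε.symm.toAddMonoidHom) fun r x => by
        have : ε.symm (op (op r) • x) = r • ε.symm x := by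
          rw [AddEquiv.symm_apply_eq, hε, AddEquiv.apply_symm_apply]
        simp [this]
      ext m
      simpa using DFunLike.congr_fun this (ε m)
    · intro h f hf
      let g : M →ₗ[R] X :=
        { f.comp ε.toAddMonoidHom with map_smul' := fun r m => by simp [hε, hf] }
      ext x
      simpa [g] using LinearMap.congr_fun (h g) (ε.symm x)
  obtain ⟨S'⟩ := T.nonempty_swap (isRegularBimodule_op R)
  have := S'.finite
  have := Module.Finite.equiv e
  obtain ⟨pr⟩ := exists_minPres (A := Rᵐᵒᵖ) (LDual R K X)
  exact ⟨fun h => (key pr).1 (h pr), fun h pr => (key pr).2 h⟩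

end Rigidity

/-- For `M` with no nonzero projective direct summand, the
following are equivalent: (1) `M` is a Gorenstein projective τ-tilting
`R`-module; (2) `Tr M` is a Gorenstein projective τ-tilting `Rᵐᵒᵖ`-module;
(3) `τM` is a Gorenstein injective τ⁻¹-tilting `R`-module. -/
theorem gp_tau_tilting_tr_tau_equiv (K R : Type u) [Field K] [Ring R] [Algebra K R]
    [FiniteDimensional K R]
    (M : Type u) [AddCommGroup M] [Module R M] [Module.Finite R M]
    (hnp : NoProjSummand R M) :
    ((IsGP R M ∧ IsTauTilting R K M) ↔
      (∀ pr : MinPres R M, IsGP Rᵐᵒᵖ pr.Tr ∧ IsTauTilting Rᵐᵒᵖ K pr.Tr)) ∧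
    ((IsGP R M ∧ IsTauTilting R K M) ↔
      (∀ pr : MinPres R M, IsGI R K (pr.tau K) ∧ IsTauInvTilting R K (pr.tau K))) := by
  have := MinPres.finiteDimensional_op K R
  have : IsNoetherianRing R := isNoetherian_of_tower K inferInstance
  have : IsArtinianRing R := isArtinian_of_tower K inferInstance
  have : IsNoetherianRing Rᵐᵒᵖ := isNoetherian_of_tower K inferInstance
  have : IsArtinianRing Rᵐᵒᵖ := isArtinian_of_tower K inferInstance
  have hW := isRegularBimodule_op R
  obtain ⟨pr₀⟩ := exists_minPres (A := R) M
  have key : ∀ pr : MinPres R M,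
      ((IsGP R M ∧ IsTauTilting R K M) ↔ (IsGP Rᵐᵒᵖ pr.Tr ∧ IsTauTilting Rᵐᵒᵖ K pr.Tr)) ∧
      ((IsGP R M ∧ IsTauTilting R K M) ↔
        (IsGI R K (pr.tau K) ∧ IsTauInvTilting R K (pr.tau K))) := fun pr => by
    obtain ⟨T⟩ := pr.nonempty_trPres hnp
    obtain ⟨S⟩ := pr.exists_dualPair_tau K
    have := pr.finiteDimensional_tr K
    have : FiniteDimensional K (pr.tau K) :=
      inferInstanceAs (FiniteDimensional K (pr.Tr →ₗ[K] K))
    have hTr := (isSumCorrespondence_trPres hW).numIndec_iff ⟨T⟩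
    have hD := (isSumCorrespondence_dualPair opEquiv).numIndec_iff ⟨S⟩
    simp only [IsTauTilting, IsTauInvTilting, T.isTauRigid_iff hnp, T.isTauRigid_op_iff,
      T.isTauInvRigid_iff S, T.isGP_iff hW, ← S.isGP_iff_isGI, hTr, hD, numIndec_self_op_iff R,
      and_self]
  exact ⟨⟨fun h pr => (key pr).1.1 h, fun h => (key pr₀).1.2 (h pr₀)⟩,
    ⟨fun h pr => (key pr).2.1 h, fun h => (key pr₀).2.2 (h pr₀)⟩⟩

end GPTau
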